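/- arXiv:2211.01782 — 12 statements merged into one kernel-verified Lean document; each statement's English description precedes it below -/
import Mathlib

section
/- Let Q be a quantale and C a Q-category on a set X. For any sequence (x_n)_{n∈ℕ} in X, the presheaves φ_x and ψ_x associated to the sequence are Q-distributors; that is, for all y, y' ∈ X one has C(y', y) ∘ φ_x(y) ≤ φ_x(y') and ψ_x(y) ∘ C(y, y') ≤ ψ_x(y'). -/
/-- For any sequence in a `Q`-category, the associated presheaves
`φ_x` and `ψ_x` are `Q`-distributors. -/
theorem sequence_presheaves_are_distributors
    {Q : Type*} [Monoid Q] [CompleteLattice Q] [IsQuantale Q]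
    {X : Type*} (C : X → X → Q)
    (hC_id : ∀ x, 1 ≤ C x x)
    (hC_comp : ∀ x y z, C x y * C y z ≤ C x z)
    (x : ℕ → X) :
    (∀ y y', C y' y * (⨆ N, ⨅ n ≥ N, C y (x n)) ≤ ⨆ N, ⨅ n ≥ N, C y' (x n)) ∧
    (∀ y y', (⨆ N, ⨅ n ≥ N, C (x n) y) * C y y' ≤ ⨆ N, ⨅ n ≥ N, C (x n) y') := by
  refine ⟨fun y y' => ?_, fun y y' => ?_⟩
  · rw [Quantale.mul_iSup_distrib]
    refine iSup_mono fun N => le_iInf₂ fun n hn => ?_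
    exact (mul_le_mul_right (iInf₂_le n hn) _).trans (hC_comp y' y (x n))
  · rw [Quantale.iSup_mul_distrib]
    refine iSup_mono fun N => le_iInf₂ fun n hn => ?_
    exact (mul_le_mul_left (iInf₂_le n hn) _).trans (hC_comp (x n) y y')
end

section
/- Let Q be a quantale and C a Q-category on a set X. A sequence (x_n)_{n∈ℕ} in X is Cauchy, i.e. 1 ≤ ⨆_{N∈ℕ} ⨅_{n,m ≥ N} C(x_n, x_m), if and only if the pair (φ_x, ψ_x) is adjoint, i.e. 1 ≤ ⨆_{y∈X} ψ_x(y) ∘ φ_x(y) and φ_x(y) ∘ ψ_x(y') ≤ C(y, y') for all y, y' ∈ X. -/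
open Quantale in
/-- A product of two suprema is bounded by any bound on the products of their terms. -/
theorem iSup_mul_iSup_le_of_forall {Q ι κ : Type*} [Semigroup Q] [CompleteLattice Q] [IsQuantale Q]
    {f : ι → Q} {g : κ → Q} {c : Q} (h : ∀ i j, f i * g j ≤ c) :
    (⨆ i, f i) * (⨆ j, g j) ≤ c := by
  rw [iSup_mul_distrib]
  refine iSup_le fun i => ?_
  rw [mul_iSup_distrib]
  exact iSup_le (h i)

/-- a sequence in a `Q`-category is Cauchy iff the associated
pair of presheaves `(φ_x, ψ_x)` is an adjoint pair. -/
theorem cauchy_iff_adjoint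
    {Q : Type*} [Monoid Q] [CompleteLattice Q] [IsQuantale Q]
    {X : Type*} (C : X → X → Q)
    (hC_id : ∀ x, 1 ≤ C x x)
    (hC_comp : ∀ x y z, C x y * C y z ≤ C x z)
    (x : ℕ → X) :
    (1 ≤ ⨆ N, ⨅ n ≥ N, ⨅ m ≥ N, C (x n) (x m)) ↔
      ((1 ≤ ⨆ y, (⨆ N, ⨅ n ≥ N, C (x n) y) * (⨆ N, ⨅ n ≥ N, C y (x n))) ∧
       (∀ y y', (⨆ N, ⨅ n ≥ N, C y (x n)) * (⨆ N, ⨅ n ≥ N, C (x n) y') ≤ C y y')) := by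
  constructor
  · refine fun h => ⟨?_, fun y y' => iSup_mul_iSup_le_of_forall fun N M => ?_⟩
    · refine (one_mul (1 : Q)).ge.trans ((mul_le_mul' h h).trans ?_)
      refine iSup_mul_iSup_le_of_forall fun N M => ?_
      refine le_iSup_of_le (x (max N M)) (mul_le_mul' ?_ ?_)
      · exact le_iSup_of_le N (le_iInf₂ fun n hn =>
          (iInf₂_le n hn).trans (iInf₂_le _ (le_max_left N M)))
      · exact le_iSup_of_le M (le_iInf₂ fun m hm =>
          (iInf₂_le _ (le_max_right N M)).trans (iInf₂_le m hm))
    · exact (mul_le_mul' (iInf₂_le _ (le_max_left N M))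
        (iInf₂_le _ (le_max_right N M))).trans (hC_comp y (x (max N M)) y')
  · rintro ⟨h, -⟩
    refine h.trans (iSup_le fun y => iSup_mul_iSup_le_of_forall fun N M => ?_)
    refine le_iSup_of_le (max N M) (le_iInf₂ fun n hn => le_iInf₂ fun m hm => ?_)
    exact (mul_le_mul' (iInf₂_le n (le_of_max_le_left hn))
      (iInf₂_le m (le_of_max_le_right hm))).trans (hC_comp (x n) y (x m))
end

section
/- Let Q be a quantale, C a Q-category on X, φ a control function on Q and f : X → X a φ-contraction. If u and u' are both fixpoints of f, then C(u, u') = 0 or 1 ≤ C(u, u'), and likewise C(u', u) = 0 or 1 ≤ C(u', u). -/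
/-- In a `Q`-category, `C x' y' ≤ C x y` as soon as `1 ≤ C x x'` and `1 ≤ C y' y`. -/
theorem hom_le_hom_of_one_le
    {Q : Type*} [Monoid Q] [CompleteLattice Q] [IsQuantale Q]
    {X : Type*} {C : X → X → Q}
    (hC_comp : ∀ x y z, C x y * C y z ≤ C x z)
    {x x' y y' : X} (hx : 1 ≤ C x x') (hy : 1 ≤ C y' y) :
    C x' y' ≤ C x y :=
  calc C x' y' ≤ C x x' * C x' y' := le_mul_of_one_le_left' hx
    _ ≤ C x y' := hC_comp x x' y'
    _ ≤ C x y' * C y' y := le_mul_of_one_le_right' hy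
    _ ≤ C x y := hC_comp x y' y

/-- for a `φ`-contraction, any two fixpoints `u, u'` satisfy
`C(u,u') = 0` or `1 ≤ C(u,u')`, and likewise for `C(u',u)`. -/
theorem fixpoints_hom_dichotomy
    {Q : Type*} [Monoid Q] [CompleteLattice Q] [IsQuantale Q]
    {X : Type*} (C : X → X → Q)
    (hC_id : ∀ x, 1 ≤ C x x)
    (hC_comp : ∀ x y z, C x y * C y z ≤ C x z)
    (φ : Q → Q)
    (hφ_le : ∀ t, t ≤ φ t)
    (hφ_fix : ∀ t, φ t = t → t = ⊥ ∨ 1 ≤ t)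
    (f : X → X)
    (hf : ∀ x y, φ (C x y) ≤ C (f x) (f y))
    (u u' : X)
    (hu : 1 ≤ C (f u) u ∧ 1 ≤ C u (f u))
    (hu' : 1 ≤ C (f u') u' ∧ 1 ≤ C u' (f u')) :
    (C u u' = ⊥ ∨ 1 ≤ C u u') ∧ (C u' u = ⊥ ∨ 1 ≤ C u' u) := by
  exact ⟨hφ_fix _ (((hf u u').trans (hom_le_hom_of_one_le hC_comp hu.2 hu'.1)).antisymm (hφ_le _)),
    hφ_fix _ (((hf u' u).trans (hom_le_hom_of_one_le hC_comp hu'.2 hu.1)).antisymm (hφ_le _))⟩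
end

section
/- Let Q be a quantale, C a symmetric Q-category on X (C(x,y) = C(y,x) for all x, y ∈ X), φ a control function on Q, and f : X → X a φ-contraction. If u and u' are both fixpoints of f, then either u ≅ u' (1 ≤ C(u, u') and 1 ≤ C(u', u)) or C(u, u') = 0. -/
/-- in a symmetric `Q`-category, any two fixpoints of a
`φ`-contraction are isomorphic or at hom `0` from each other. -/
theorem fixpoints_isomorphic_or_zero_of_symmetric
    {Q : Type*} [Monoid Q] [CompleteLattice Q] [IsQuantale Q]
    {X : Type*} (C : X → X → Q)
    (hC_id : ∀ x, 1 ≤ C x x)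
    (hC_comp : ∀ x y z, C x y * C y z ≤ C x z)
    (hC_symm : ∀ x y, C x y = C y x)
    (φ : Q → Q)
    (hφ_le : ∀ t, t ≤ φ t)
    (hφ_fix : ∀ t, φ t = t → t = ⊥ ∨ 1 ≤ t)
    (f : X → X)
    (hf : ∀ x y, φ (C x y) ≤ C (f x) (f y))
    (u u' : X)
    (hu : 1 ≤ C (f u) u ∧ 1 ≤ C u (f u))
    (hu' : 1 ≤ C (f u') u' ∧ 1 ≤ C u' (f u')) :
    (1 ≤ C u u' ∧ 1 ≤ C u' u) ∨ C u u' = ⊥ := by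
  have hle : C (f u) (f u') ≤ C u u' :=
    calc C (f u) (f u') = 1 * (C (f u) (f u') * 1) := by rw [mul_one, one_mul]
      _ ≤ C u (f u) * (C (f u) (f u') * C (f u') u') :=
        mul_le_mul' hu.2 (mul_le_mul' le_rfl hu'.1)
      _ ≤ C u (f u) * C (f u) u' := mul_le_mul' le_rfl (hC_comp _ _ _)
      _ ≤ C u u' := hC_comp _ _ _
  have hfix : φ (C u u') = C u u' := le_antisymm ((hf u u').trans hle) (hφ_le _)
  rcases hφ_fix _ hfix with h | h
  · exact Or.inr h
  · exact Or.inl ⟨h, hC_symm u u' ▸ h⟩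
end

section
/- Let Q be a quantale, C a Q-category on X, φ a sequentially lower-semicontinuous control function on Q, and f : X → X a φ-contraction. If x ∈ X satisfies C(x, f x) ≠ 0, then the sequence c_n := C(f^n x, f^{n+1} x) is increasing and satisfies 1 ≤ ⨆_{n∈ℕ} c_n. -/
theorem Monotone.iSup_iInf_ge_eq_iSup {ι α : Type*} [Preorder ι] [CompleteLattice α]
    {u : ι → α} (hu : Monotone u) : ⨆ i, ⨅ j ≥ i, u j = ⨆ i, u i :=
  iSup_congr fun i => le_antisymm (iInf₂_le i le_rfl) (le_iInf₂ fun _ hj => hu hj)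


/-- for a `φ`-contraction with sequentially lower-semicontinuous
control function, if `C(x, f x) ≠ 0` then the sequence
`c n = C(fⁿ x, fⁿ⁺¹ x)` is increasing with `1 ≤ ⨆ n, c n`. -/
theorem consecutive_homs_increasing_sup_ge_one
    {Q : Type*} [Monoid Q] [CompleteLattice Q] [IsQuantale Q]
    {X : Type*} (C : X → X → Q)
    (hC_id : ∀ x, 1 ≤ C x x)
    (hC_comp : ∀ x y z, C x y * C y z ≤ C x z)
    (φ : Q → Q)
    (hφ_le : ∀ t, t ≤ φ t)
    (hφ_fix : ∀ t, φ t = t → t = ⊥ ∨ 1 ≤ t)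
    (hφ_lsc : ∀ t : ℕ → Q, φ (⨆ N, ⨅ n ≥ N, t n) ≤ ⨆ N, ⨅ n ≥ N, φ (t n))
    (f : X → X)
    (hf : ∀ x y, φ (C x y) ≤ C (f x) (f y))
    (x : X) (hx : C x (f x) ≠ ⊥) :
    Monotone (fun n => C (f^[n] x) (f^[n + 1] x)) ∧
      1 ≤ ⨆ n, C (f^[n] x) (f^[n + 1] x) := by
  have hstep : ∀ n, φ (C (f^[n] x) (f^[n + 1] x)) ≤ C (f^[n + 1] x) (f^[n + 1 + 1] x) := by
    intro n
    rw [Function.iterate_succ_apply' f (n + 1) x]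
    nth_rewrite 2 [Function.iterate_succ_apply' f n x]
    exact hf _ _
  have hmono : Monotone (fun n => C (f^[n] x) (f^[n + 1] x)) :=
    monotone_nat_of_le_succ fun n => (hφ_le _).trans (hstep n)
  refine ⟨hmono, ?_⟩
  have hfix : φ (⨆ n, C (f^[n] x) (f^[n + 1] x)) = ⨆ n, C (f^[n] x) (f^[n + 1] x) := by
    refine le_antisymm ?_ (hφ_le _)
    calc φ (⨆ n, C (f^[n] x) (f^[n + 1] x))
        = φ (⨆ N, ⨅ n ≥ N, C (f^[n] x) (f^[n + 1] x)) := by rw [hmono.iSup_iInf_ge_eq_iSup]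
      _ ≤ ⨆ N, ⨅ n ≥ N, φ (C (f^[n] x) (f^[n + 1] x)) := hφ_lsc _
      _ ≤ ⨆ n, C (f^[n] x) (f^[n + 1] x) := iSup_le fun N =>
          (iInf₂_le N le_rfl).trans <| (hstep N).trans <|
            le_iSup (fun n => C (f^[n] x) (f^[n + 1] x)) (N + 1)
  exact (hφ_fix _ hfix).resolve_left fun hbot => hx (iSup_eq_bot.mp hbot 0)
end

section
/- Let Q be a quantale whose underlying complete lattice is continuous, C a Q-category on X, φ a sequentially lower-semicontinuous control function on Q, and f : X → X a φ-contraction. If x ∈ X satisfies C(x, f x) ≠ 0 and C(f x, x) ≠ 0, then the sequence (f^n x)_{n∈ℕ} is Cauchy, i.e. 1 ≤ ⨆_{N∈ℕ} ⨅_{n,m ≥ N} C(f^n x, f^m x). -/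
/-- `a` is way below `b` in a complete lattice. -/
def WayBelow {L : Type*} [CompleteLattice L] (a b : L) : Prop :=
  ∀ D : Set L, D.Nonempty → DirectedOn (· ≤ ·) D → b ≤ sSup D → ∃ d ∈ D, a ≤ d

/-- A complete lattice is continuous if every element is the supremum of the
elements way below it. -/
def IsContinuousLattice (L : Type*) [CompleteLattice L] : Prop :=
  ∀ a : L, a = sSup {u | WayBelow u a}

open Filter

namespace QuantaleLiminf

variable {Q : Type*} [CompleteLattice Q]

lemma liminf_mul_liminf_le [Monoid Q] [IsQuantale Q] (p q : ℕ → Q) :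
    liminf p atTop * liminf q atTop ≤ liminf (fun k => p k * q k) atTop := by
  simp only [liminf_eq_iSup_iInf_of_nat, Quantale.iSup_mul_distrib, Quantale.mul_iSup_distrib]
  refine iSup_le fun M => iSup_le fun N => le_iSup_of_le (max N M) (le_iInf₂ fun k hk => ?_)
  have hN : k ≥ N := le_of_max_le_left hk
  have hM : k ≥ M := le_of_max_le_right hk
  exact mul_le_mul' (iInf₂_le k hN) (iInf₂_le k hM)

lemma iSup_le_liminf_comp {a : ℕ → Q} (ha : Monotone a) {n : ℕ → ℕ} (hn : Tendsto n atTop atTop) :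
    ⨆ i, a i ≤ liminf (fun k => a (n k)) atTop :=
  iSup_le fun i => le_liminf_of_le (by isBoundedDefault)
    ((hn.eventually_ge_atTop i).mono fun _ hk => ha hk)

lemma liminf_eq_iSup_of_monotone {a : ℕ → Q} (ha : Monotone a) :
    liminf a atTop = ⨆ i, a i :=
  le_antisymm (by
    rw [liminf_eq_iSup_iInf_of_nat]
    exact iSup_mono fun i => iInf₂_le i le_rfl) (iSup_le_liminf_comp ha tendsto_id)

/-- An element way below the limit inferior of a sequence is eventually below the sequence. -/
lemma _root_.WayBelow.eventually_le {u b : Q} (hu : WayBelow u b) {t : ℕ → Q}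
    (hb : b ≤ liminf t atTop) : ∀ᶠ k in atTop, u ≤ t k := by
  rw [liminf_eq_iSup_iInf_of_nat] at hb
  have hmono : Monotone fun N => ⨅ k ≥ N, t k := fun N M hNM =>
    le_iInf₂ fun k hk => iInf₂_le k (le_trans hNM hk)
  obtain ⟨_, ⟨N, rfl⟩, hN⟩ := hu _ (Set.range_nonempty _)
    (directedOn_range.2 hmono.directed_le) hb
  exact eventually_atTop.2 ⟨N, fun k hk => hN.trans (iInf₂_le k hk)⟩

lemma _root_.WayBelow.le {u b : Q} (hu : WayBelow u b) : u ≤ b := by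
  obtain ⟨d, rfl, h⟩ := hu {b} (Set.singleton_nonempty b) (directedOn_singleton b) (by simp)
  exact h

variable {φ : Q → Q}

lemma monotone_of_map_liminf_le
    (hφ_lsc : ∀ t : ℕ → Q, φ (liminf t atTop) ≤ liminf (fun n => φ (t n)) atTop) :
    Monotone φ := by
  intro s t hst
  let r : ℕ → Q := fun n => if Even n then s else t
  have hs : s ≤ liminf r atTop := le_liminf_of_le (by isBoundedDefault)
    (Eventually.of_forall fun n => by dsimp only [r]; split_ifs <;> [exact le_rfl; exact hst])
  have hr (g : Q → Q) : liminf (fun n => g (r n)) atTop ≤ g s ⊓ g t := by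
    rw [liminf_eq_iSup_iInf_of_nat]
    refine iSup_le fun N => le_inf ?_ ?_
    · exact (iInf₂_le (2 * N) (by omega)).trans (by simp [r])
    · exact (iInf₂_le (2 * N + 1) (by omega)).trans (by simp [r])
  have hrs : liminf r atTop = s := le_antisymm ((hr id).trans inf_le_left) hs
  have := (hφ_lsc r).trans (hr φ)
  rw [hrs] at this
  exact this.trans inf_le_right

lemma one_le_iSup_of_map_le_succ [One Q] (hφ_le : ∀ t, t ≤ φ t)
    (hφ_fix : ∀ t, φ t = t → t = ⊥ ∨ 1 ≤ t)
    (hφ_lsc : ∀ t : ℕ → Q, φ (liminf t atTop) ≤ liminf (fun n => φ (t n)) atTop)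
    {a : ℕ → Q} (ha : ∀ n, φ (a n) ≤ a (n + 1)) (ha₀ : a 0 ≠ ⊥) : 1 ≤ ⨆ i, a i := by
  have hmono : Monotone a := monotone_nat_of_le_succ fun n => (hφ_le _).trans (ha n)
  have hφa : φ (⨆ i, a i) ≤ ⨆ i, a i := by
    have h := hφ_lsc a
    rw [liminf_eq_iSup_of_monotone hmono,
      liminf_eq_iSup_of_monotone fun i j hij => monotone_of_map_liminf_le hφ_lsc (hmono hij)] at h
    exact h.trans (iSup_le fun i => (ha i).trans (le_iSup a (i + 1)))
  refine (hφ_fix _ (hφa.antisymm (hφ_le _))).resolve_left fun h => ha₀ ?_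
  exact eq_bot_iff.2 ((le_iSup a 0).trans h.le)

/-- A double sequence `D` is eventually above `u` beyond the diagonal as soon as moving one step
away from the diagonal preserves being above `u` in the limit, and limits inferior of `D` are
stable under `φ`. -/
lemma exists_forall_le_of_wayBelow [One Q] (hφ_le : ∀ t, t ≤ φ t)
    (hφ_fix : ∀ t, φ t = t → t = ⊥ ∨ 1 ≤ t)
    (hφ_lsc : ∀ t : ℕ → Q, φ (liminf t atTop) ≤ liminf (fun n => φ (t n)) atTop)
    {u : Q} (hu : WayBelow u 1) {D : ℕ → ℕ → Q} (hdiag : ∀ n, 1 ≤ D n n)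
    (hstep : ∀ n j : ℕ → ℕ, Tendsto j atTop atTop → (∀ k, u ≤ D (n k) (j k)) →
      u ≤ liminf (fun k => D (n k) (j k + 1)) atTop)
    (hshift : ∀ n j : ℕ → ℕ, Tendsto n atTop atTop → Tendsto j atTop atTop →
      liminf (fun k => φ (D (n k) (j k))) atTop ≤ liminf (fun k => D (n k) (j k)) atTop) :
    ∃ N, ∀ n ≥ N, ∀ m ≥ n, u ≤ D n m := by
  by_contra hcon
  have hex : ∀ N, ∃ n j, N ≤ n ∧ n ≤ j ∧ u ≤ D n j ∧ ¬ u ≤ D n (j + 1) := by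
    intro N
    by_contra! h
    refine hcon ⟨N, fun n hn m hm => ?_⟩
    induction m, hm using Nat.le_induction with
    | base => exact hu.le.trans (hdiag n)
    | succ j hj ih => exact h n j hn hj ih
  choose n j hn hj hle hnot using hex
  have hntop : Tendsto n atTop atTop := tendsto_atTop_mono hn tendsto_id
  have hjtop : Tendsto j atTop atTop := tendsto_atTop_mono hj hntop
  have hus := hstep n j hjtop hle
  have hfix := (hφ_lsc _).trans
    (hshift n (fun k => j k + 1) hntop ((tendsto_add_atTop_nat 1).comp hjtop))
  rcases hφ_fix _ (hfix.antisymm (hφ_le _)) with h | h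
  · rw [h] at hus
    exact hnot 0 (hus.trans bot_le)
  · obtain ⟨k, hk⟩ := (hu.eventually_le h).exists
    exact hnot k hk

end QuantaleLiminf

open QuantaleLiminf

/-- over a quantale with continuous underlying lattice, the Picard
sequence of a `φ`-contraction (with sequentially lower-semicontinuous control
function) starting at a point `x` with `C(x,fx) ≠ 0 ≠ C(fx,x)` is Cauchy. -/
theorem picard_sequence_cauchy
    {Q : Type*} [Monoid Q] [CompleteLattice Q] [IsQuantale Q]
    (hQ : IsContinuousLattice Q)
    {X : Type*} (C : X → X → Q)
    (hC_id : ∀ x, 1 ≤ C x x)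
    (hC_comp : ∀ x y z, C x y * C y z ≤ C x z)
    (φ : Q → Q)
    (hφ_le : ∀ t, t ≤ φ t)
    (hφ_fix : ∀ t, φ t = t → t = ⊥ ∨ 1 ≤ t)
    (hφ_lsc : ∀ t : ℕ → Q, φ (⨆ N, ⨅ n ≥ N, t n) ≤ ⨆ N, ⨅ n ≥ N, φ (t n))
    (f : X → X)
    (hf : ∀ x y, φ (C x y) ≤ C (f x) (f y))
    (x : X) (hx₁ : C x (f x) ≠ ⊥) (hx₂ : C (f x) x ≠ ⊥) :
    1 ≤ ⨆ N, ⨅ n ≥ N, ⨅ m ≥ N, C (f^[n] x) (f^[m] x) := by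
  simp only [← liminf_eq_iSup_iInf_of_nat] at hφ_lsc
  have hshift (i j : ℕ) : φ (C (f^[i] x) (f^[j] x)) ≤ C (f^[i + 1] x) (f^[j + 1] x) := by
    simpa only [Function.iterate_succ_apply'] using hf (f^[i] x) (f^[j] x)
  have hmono {a : ℕ → Q} (ha : ∀ n, φ (a n) ≤ a (n + 1)) : Monotone a :=
    monotone_nat_of_le_succ fun n => (hφ_le _).trans (ha n)
  have one_le {a : ℕ → Q} (ha : ∀ n, φ (a n) ≤ a (n + 1)) (ha₀ : a 0 ≠ ⊥) {n : ℕ → ℕ}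
      (hn : Tendsto n atTop atTop) : 1 ≤ liminf (fun k => a (n k)) atTop :=
    (one_le_iSup_of_map_le_succ hφ_le hφ_fix hφ_lsc ha ha₀).trans
      (iSup_le_liminf_comp (hmono ha) hn)
  have hfwd {n : ℕ → ℕ} (hn : Tendsto n atTop atTop) :
      1 ≤ liminf (fun k => C (f^[n k] x) (f^[n k + 1] x)) atTop :=
    one_le (a := fun i => C (f^[i] x) (f^[i + 1] x)) (fun i => hshift i (i + 1)) hx₁ hn
  have hbwd {n : ℕ → ℕ} (hn : Tendsto n atTop atTop) :
      1 ≤ liminf (fun k => C (f^[n k + 1] x) (f^[n k] x)) atTop :=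
    one_le (a := fun i => C (f^[i + 1] x) (f^[i] x)) (fun i => hshift (i + 1) i) hx₂ hn
  have hstable (n j : ℕ → ℕ) (hn : Tendsto n atTop atTop) (hj : Tendsto j atTop atTop) :
      liminf (fun k => φ (C (f^[n k] x) (f^[j k] x))) atTop ≤
        liminf (fun k => C (f^[n k] x) (f^[j k] x)) atTop := by
    calc
      _ ≤ liminf (fun k => C (f^[n k + 1] x) (f^[j k + 1] x)) atTop :=
        liminf_le_liminf (Eventually.of_forall fun k => hshift _ _)
      _ ≤ liminf (fun k => C (f^[n k] x) (f^[n k + 1] x)) atTop *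
          liminf (fun k => C (f^[n k + 1] x) (f^[j k + 1] x)) atTop *
          liminf (fun k => C (f^[j k + 1] x) (f^[j k] x)) atTop := by
        simpa only [one_mul, mul_one] using
          mul_le_mul' (mul_le_mul' (hfwd hn) le_rfl) (hbwd hj)
      _ ≤ _ := (mul_le_mul' (liminf_mul_liminf_le _ _) le_rfl).trans (liminf_mul_liminf_le _ _)
      _ ≤ _ := liminf_le_liminf (Eventually.of_forall fun k =>
        (mul_le_mul' (hC_comp _ _ _) le_rfl).trans (hC_comp _ _ _))
  have le_liminf {u : Q} {t : ℕ → Q} (ht : ∀ k, u ≤ t k) : u ≤ liminf t atTop :=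
    le_liminf_of_le (by isBoundedDefault) (Eventually.of_forall ht)
  conv_lhs => rw [hQ 1]
  refine sSup_le fun u hu => ?_
  obtain ⟨N, hN⟩ := exists_forall_le_of_wayBelow hφ_le hφ_fix hφ_lsc hu
    (D := fun i j => C (f^[i] x) (f^[j] x)) (fun _ => hC_id _)
    (fun n j hj hle => by
      calc
        u ≤ _ := by simpa only [mul_one] using mul_le_mul' (le_liminf hle) (hfwd hj)
        _ ≤ _ := liminf_mul_liminf_le _ _
        _ ≤ _ := liminf_le_liminf (Eventually.of_forall fun k => hC_comp _ _ _))
    hstable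
  obtain ⟨M, hM⟩ := exists_forall_le_of_wayBelow hφ_le hφ_fix hφ_lsc hu
    (D := fun i j => C (f^[j] x) (f^[i] x)) (fun _ => hC_id _)
    (fun n j hj hle => by
      calc
        u ≤ _ := by simpa only [one_mul] using mul_le_mul' (hbwd hj) (le_liminf hle)
        _ ≤ _ := liminf_mul_liminf_le _ _
        _ ≤ _ := liminf_le_liminf (Eventually.of_forall fun k => hC_comp _ _ _))
    (fun n j hn hj => hstable j n hj hn)
  refine le_iSup_of_le (max N M) (le_iInf₂ fun n hn => le_iInf₂ fun m hm => ?_)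
  rcases le_total n m with h | h
  · exact hN n (le_trans (le_max_left _ _) hn) m h
  · exact hM m (le_trans (le_max_right _ _) hm) n h
end

section
/- Let Q be any quantale, C a Cauchy-complete Q-category on X, and f : X → X a Q-functor (C(x,y) ≤ C(f x, f y) for all x, y). Suppose there exists x ∈ X such that the presheaves φ_{x,f}(y) := ⨆_{N∈ℕ} ⨅_{n ≥ N} C(y, f^n x) and ψ_{x,f}(y) := ⨆_{N∈ℕ} ⨅_{n ≥ N} C(f^n x, y) form an adjoint pair, i.e. 1 ≤ ⨆_{y∈X} ψ_{x,f}(y) ∘ φ_{x,f}(y) and φ_{x,f}(y) ∘ ψ_{x,f}(y') ≤ C(y, y') for all y, y'. Then f has a fixpoint; more precisely, any u ∈ X with φ_{x,f}(y) = C(y, u) and ψ_{x,f}(y) = C(u, y) for all y satisfies 1 ≤ C(f u, u) and 1 ≤ C(u, f u). -/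
section EventualHom

variable {Q X : Type*} [CompleteLattice Q] {C : X → X → Q}

theorem mul_iSup_iInf_hom_le [Monoid Q] [IsQuantale Q]
    (hC_comp : ∀ x y z, C x y * C y z ≤ C x z) (s : ℕ → X) (y y' : X) :
    C y' y * (⨆ N, ⨅ n ≥ N, C y (s n)) ≤ ⨆ N, ⨅ n ≥ N, C y' (s n) := by
  rw [Quantale.mul_iSup_distrib]
  refine iSup_mono fun N => le_iInf₂ fun n hn => ?_
  exact (mul_le_mul_right (iInf₂_le n hn) _).trans (hC_comp y' y (s n))

theorem iSup_iInf_hom_mul_le [Monoid Q] [IsQuantale Q]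
    (hC_comp : ∀ x y z, C x y * C y z ≤ C x z) (s : ℕ → X) (y y' : X) :
    (⨆ N, ⨅ n ≥ N, C (s n) y) * C y y' ≤ ⨆ N, ⨅ n ≥ N, C (s n) y' := by
  rw [Quantale.iSup_mul_distrib]
  refine iSup_mono fun N => le_iInf₂ fun n hn => ?_
  exact (mul_le_mul_left (iInf₂_le n hn) _).trans (hC_comp (s n) y y')

theorem iSup_iInf_le_of_le_succ {a b : ℕ → Q} (h : ∀ n, a n ≤ b (n + 1)) :
    (⨆ N, ⨅ n ≥ N, a n) ≤ ⨆ N, ⨅ n ≥ N, b n := by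
  refine iSup_le fun N => le_iSup_of_le (N + 1) (le_iInf₂ fun n hn => ?_)
  obtain ⟨m, rfl⟩ : ∃ m, n = m + 1 := ⟨n - 1, by omega⟩
  exact (iInf₂_le m (by omega)).trans (h m)

end EventualHom

/-- on a Cauchy-complete `Q`-category, a `Q`-functor `f` such that
for some `x` the presheaves `φ_{x,f} ⊣ ψ_{x,f}` form an adjoint pair has a
fixpoint; more precisely, any representing object of this adjoint pair is a
fixpoint of `f`. -/
theorem fixpoint_of_adjoint_pair
    {Q : Type*} [Monoid Q] [CompleteLattice Q] [IsQuantale Q]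
    {X : Type*} (C : X → X → Q)
    (hC_id : ∀ x, 1 ≤ C x x)
    (hC_comp : ∀ x y z, C x y * C y z ≤ C x z)
    (hcc : ∀ φ ψ : X → Q,
      (∀ y y', C y' y * φ y ≤ φ y') →
      (∀ y y', ψ y * C y y' ≤ ψ y') →
      (1 ≤ ⨆ y, ψ y * φ y) →
      (∀ y y', φ y * ψ y' ≤ C y y') →
      ∃ u, (∀ y, φ y = C y u) ∧ (∀ y, ψ y = C u y))
    (f : X → X)
    (hf : ∀ x y, C x y ≤ C (f x) (f y))
    (x : X)
    (hadj₁ : 1 ≤ ⨆ y, (⨆ N, ⨅ n ≥ N, C (f^[n] x) y) * (⨆ N, ⨅ n ≥ N, C y (f^[n] x)))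
    (hadj₂ : ∀ y y',
      (⨆ N, ⨅ n ≥ N, C y (f^[n] x)) * (⨆ N, ⨅ n ≥ N, C (f^[n] x) y') ≤ C y y') :
    (∃ u : X, 1 ≤ C (f u) u ∧ 1 ≤ C u (f u)) ∧
    (∀ u : X,
      (∀ y, (⨆ N, ⨅ n ≥ N, C y (f^[n] x)) = C y u) →
      (∀ y, (⨆ N, ⨅ n ≥ N, C (f^[n] x) y) = C u y) →
      1 ≤ C (f u) u ∧ 1 ≤ C u (f u)) := by
  have key : ∀ u : X,
      (∀ y, (⨆ N, ⨅ n ≥ N, C y (f^[n] x)) = C y u) →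
      (∀ y, (⨆ N, ⨅ n ≥ N, C (f^[n] x) y) = C u y) →
      1 ≤ C (f u) u ∧ 1 ≤ C u (f u) := by
    intro u hφ hψ
    constructor
    · refine (hC_id u).trans ?_
      rw [← hφ u, ← hφ (f u)]
      refine iSup_iInf_le_of_le_succ fun n => ?_
      rw [Function.iterate_succ_apply']
      exact hf _ _
    · refine (hC_id u).trans ?_
      rw [← hψ u, ← hψ (f u)]
      refine iSup_iInf_le_of_le_succ fun n => ?_
      rw [Function.iterate_succ_apply']
      exact hf _ _
  obtain ⟨u, hφ, hψ⟩ := hcc _ _ (mul_iSup_iInf_hom_le hC_comp fun n => f^[n] x)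
    (iSup_iInf_hom_mul_le hC_comp fun n => f^[n] x) hadj₁ hadj₂
  exact ⟨⟨u, key u hφ hψ⟩, key⟩
end

section
/- Let (X, edist) be a complete extended metric space (edist taking values in [0,∞]). Let φ : [0,∞] → [0,∞] satisfy φ(0) = 0, φ(t) < t for all t with 0 < t < ∞, and limsup_{n} φ(t_n) ≤ φ(limsup_{n} t_n) for every sequence (t_n) in [0,∞] (sequential upper-semicontinuity along limsups). Let f : X → X satisfy edist(f x, f y) ≤ φ(edist(x, y)) for all x, y ∈ X. If there exists x ∈ X with edist(x, f x) ≠ ∞, then the sequence of iterates (f^n x)_{n∈ℕ} converges to a point u ∈ X with f u = u. -/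
open Filter

theorem ENNReal.apply_le_of_apply_lt {φ : ENNReal → ENNReal} (hφ0 : φ 0 = 0)
    (hφlt : ∀ t : ENNReal, 0 < t → t < ⊤ → φ t < t) (t : ENNReal) : φ t ≤ t := by
  rcases eq_or_ne t 0 with rfl | h0
  · exact hφ0.le
  rcases eq_or_ne t ⊤ with rfl | ht
  · exact le_top
  · exact (hφlt t (pos_iff_ne_zero.2 h0) ht.lt_top).le

/-- A sequentially upper-semicontinuous `φ` with `φ t < t` satisfies a Meir–Keeler condition. -/
theorem ENNReal.exists_pos_forall_lt_add_apply_lt {φ : ENNReal → ENNReal} (hφ0 : φ 0 = 0)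
    (hφlt : ∀ t : ENNReal, 0 < t → t < ⊤ → φ t < t)
    (hφusc : ∀ t : ℕ → ENNReal, limsup (fun n => φ (t n)) atTop ≤ φ (limsup t atTop))
    {ε : ENNReal} (hε : 0 < ε) (hε' : ε < ⊤) :
    ∃ δ > 0, ∀ t < ε + δ, φ t < ε := by
  by_contra! h
  choose t ht hφt using fun n : ℕ => h (n : ENNReal)⁻¹ (by simp)
  have hle : ∀ n, ε ≤ t n := fun n => (hφt n).trans (apply_le_of_apply_lt hφ0 hφlt _)
  have hlim : Tendsto t atTop (nhds ε) := by
    refine tendsto_of_tendsto_of_tendsto_of_le_of_le tendsto_const_nhds ?_ hle fun n => (ht n).le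
    simpa using tendsto_const_nhds.add ENNReal.tendsto_inv_nat_nhds_zero
  have key := hφusc t
  rw [hlim.limsup_eq] at key
  have hlow : ε ≤ limsup (fun n => φ (t n)) atTop :=
    le_limsup_of_frequently_le (Frequently.of_forall hφt)
  exact (hφlt ε hε hε').not_ge (hlow.trans key)

/-- Consecutive iterates of a `φ`-contraction become arbitrarily close. -/
theorem tendsto_edist_iterate_succ_of_edist_le {X : Type*} [PseudoEMetricSpace X]
    {φ : ENNReal → ENNReal} (hφ0 : φ 0 = 0)
    (hφlt : ∀ t : ENNReal, 0 < t → t < ⊤ → φ t < t)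
    (hφusc : ∀ t : ℕ → ENNReal, limsup (fun n => φ (t n)) atTop ≤ φ (limsup t atTop))
    {f : X → X} (hf : ∀ x y, edist (f x) (f y) ≤ φ (edist x y))
    {x : X} (hx : edist x (f x) ≠ ⊤) :
    Tendsto (fun n => edist (f^[n] x) (f^[n + 1] x)) atTop (nhds 0) := by
  set a : ℕ → ENNReal := fun n => edist (f^[n] x) (f^[n + 1] x) with ha
  have hstep : ∀ n, a (n + 1) ≤ φ (a n) := fun n => by
    simpa only [ha, Function.iterate_succ_apply'] using hf (f^[n] x) (f^[n + 1] x)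
  have hanti : Antitone a := antitone_nat_of_succ_le fun n =>
    (hstep n).trans (ENNReal.apply_le_of_apply_lt hφ0 hφlt _)
  have hlim : Tendsto a atTop (nhds (⨅ n, a n)) := tendsto_atTop_iInf hanti
  have hfin : ⨅ n, a n < ⊤ := (iInf_le a 0).trans_lt (by simpa [ha] using hx.lt_top)
  rcases eq_or_ne (⨅ n, a n) 0 with h0 | h0
  · rwa [h0] at hlim
  have key := hφusc a
  rw [hlim.limsup_eq] at key
  have hlow : ⨅ n, a n ≤ limsup (fun n => φ (a n)) atTop :=
    le_limsup_of_frequently_le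
      (Frequently.of_forall fun n => (iInf_le a (n + 1)).trans (hstep n))
  exact absurd (hlow.trans key) (hφlt _ (pos_iff_ne_zero.2 h0) hfin).not_ge

theorem cauchySeq_iterate_of_edist_le {X : Type*} [PseudoEMetricSpace X]
    {φ : ENNReal → ENNReal} (hφ0 : φ 0 = 0)
    (hφlt : ∀ t : ENNReal, 0 < t → t < ⊤ → φ t < t)
    (hφusc : ∀ t : ℕ → ENNReal, limsup (fun n => φ (t n)) atTop ≤ φ (limsup t atTop))
    {f : X → X} (hf : ∀ x y, edist (f x) (f y) ≤ φ (edist x y))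
    {x : X} (hx : edist x (f x) ≠ ⊤) :
    CauchySeq fun n => f^[n] x := by
  refine EMetric.cauchySeq_iff'.2 fun ε hε => ?_
  obtain ⟨η, hη, hηε⟩ := exists_between hε
  obtain ⟨δ, hδ, hφδ⟩ := ENNReal.exists_pos_forall_lt_add_apply_lt hφ0 hφlt hφusc hη
    (hηε.trans_le le_top)
  obtain ⟨ρ, hρ, hρδ⟩ : ∃ ρ > 0, ρ ≤ δ ∧ η + ρ ≤ ε :=
    ⟨min δ (ε - η), lt_min hδ (tsub_pos_of_lt hηε), min_le_left _ _,
      (add_le_add_right (min_le_right _ _) η).trans (add_tsub_cancel_of_le hηε.le).le⟩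
  obtain ⟨N, hN⟩ := ((tendsto_edist_iterate_succ_of_edist_le hφ0 hφlt hφusc hf hx).eventually
    (gt_mem_nhds hρ)).exists
  have hclose : ∀ k, edist (f^[N] x) (f^[N + k] x) < η + ρ := by
    intro k
    induction k with
    | zero => simpa using Or.inl hη
    | succ k ih =>
      calc edist (f^[N] x) (f^[N + k + 1] x)
          ≤ edist (f^[N] x) (f^[N + 1] x) + edist (f^[N + 1] x) (f^[N + k + 1] x) :=
            edist_triangle _ _ _
        _ < ρ + η := by
            refine ENNReal.add_lt_add hN ?_
            simp only [Function.iterate_succ_apply']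
            exact (hf _ _).trans_lt (hφδ _ (ih.trans_le (by gcongr; exact hρδ.1)))
        _ = η + ρ := add_comm _ _
  refine ⟨N, fun n hn => ?_⟩
  obtain ⟨k, rfl⟩ := Nat.exists_eq_add_of_le hn
  rw [edist_comm]
  exact (hclose k).trans_le hρδ.2

/-- Boyd–Wong-type fixpoint theorem for complete extended metric
spaces: if `φ(0) = 0`, `φ(t) < t` for `0 < t < ∞`, `φ` is sequentially
upper-semicontinuous along limsups, `f` is a `φ`-contraction, and some `x` has
`edist x (f x) ≠ ∞`, then the Picard sequence at `x` converges to a fixpoint. -/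
theorem emetric_fixpoint
    {X : Type*} [EMetricSpace X] [CompleteSpace X]
    (φ : ENNReal → ENNReal)
    (hφ0 : φ 0 = 0)
    (hφlt : ∀ t : ENNReal, 0 < t → t < ⊤ → φ t < t)
    (hφusc : ∀ t : ℕ → ENNReal,
      limsup (fun n => φ (t n)) atTop ≤ φ (limsup t atTop))
    (f : X → X)
    (hf : ∀ x y, edist (f x) (f y) ≤ φ (edist x y))
    (x : X) (hx : edist x (f x) ≠ ⊤) :
    ∃ u : X, Tendsto (fun n => f^[n] x) atTop (nhds u) ∧ f u = u := by
  obtain ⟨u, hu⟩ := cauchySeq_tendsto_of_complete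
    (cauchySeq_iterate_of_edist_le hφ0 hφlt hφusc hf hx)
  have hlip : LipschitzWith 1 f := fun y z => by
    simpa using (hf y z).trans (ENNReal.apply_le_of_apply_lt hφ0 hφlt _)
  exact ⟨u, hu, isFixedPt_of_tendsto_iterate hu hlip.continuous.continuousAt⟩
end

section
/- Boyd–Wong fixpoint theorem: Let (X, d) be a nonempty complete metric space and φ : [0,∞) → [0,∞) an upper-semicontinuous function with φ(t) < t for all t > 0. If f : X → X satisfies d(f x, f y) ≤ φ(d(x, y)) for all x, y ∈ X, then f has a unique fixpoint u ∈ X (f u = u), and for every x ∈ X the sequence of iterates (f^n x)_{n∈ℕ} converges to u. -/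
open Filter

/-- If `φ` is upper-semicontinuous and `φ t < t` for all `t > 0`, then a sequence dominated by
`φ ∘ s` with `s` converging to `t` cannot converge to `t`, unless `t = 0`. -/
theorem eq_zero_of_tendsto_of_le_usc {φ : NNReal → NNReal}
    (hφusc : ∀ (t : NNReal) (s : ℕ → NNReal), Tendsto s atTop (nhds t) →
      limsup (fun n => φ (s n)) atTop ≤ φ t)
    (hφlt : ∀ t : NNReal, 0 < t → φ t < t) {t : NNReal} {s r : ℕ → NNReal}
    (hs : Tendsto s atTop (nhds t)) (hr : Tendsto r atTop (nhds t))
    (hrs : ∀ n, r n ≤ φ (s n)) : t = 0 := by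
  by_contra ht
  have hpos : 0 < t := pos_iff_ne_zero.2 ht
  obtain ⟨c, hc, hct⟩ := exists_between (hφlt t hpos)
  have hbdd : IsBoundedUnder (· ≤ ·) atTop fun n => φ (s n) := by
    obtain ⟨b, hb⟩ := hs.isBoundedUnder_le
    refine ⟨b, ?_⟩
    rw [eventually_map] at hb ⊢
    filter_upwards [hb, hs.eventually_const_lt hpos] with n hn hn'
    exact (hφlt _ hn').le.trans hn
  have hlt : ∀ᶠ n in atTop, φ (s n) < c :=
    eventually_lt_of_limsup_lt ((hφusc t s hs).trans_lt hc) hbdd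
  exact hct.not_ge (le_of_tendsto hr (hlt.mono fun n hn => (hrs n).trans hn.le))

/-- A Picard sequence of a map is Cauchy if its consecutive distances are antitone and tend to zero
and the map cannot preserve a positive limiting distance. -/
theorem cauchySeq_iterate_of_eq_zero {X : Type*} [MetricSpace X] {f : X → X}
    (hf0 : ∀ (p q : ℕ → X) (t : ℝ), Tendsto (fun n => dist (p n) (q n)) atTop (nhds t) →
      Tendsto (fun n => dist (f (p n)) (f (q n))) atTop (nhds t) → t = 0)
    {x : X} (hanti : Antitone fun n => dist (f^[n] x) (f^[n + 1] x))
    (hlim : Tendsto (fun n => dist (f^[n] x) (f^[n + 1] x)) atTop (nhds 0)) :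
    CauchySeq fun n => f^[n] x := by
  by_contra hC
  rw [Metric.cauchySeq_iff'] at hC
  push Not at hC
  obtain ⟨ε, hε, hfar⟩ := hC
  have hm : ∀ k, ∃ m ≥ k, ε ≤ dist (f^[m + 1] x) (f^[k] x) ∧ dist (f^[m] x) (f^[k] x) < ε := by
    intro k
    classical
    obtain ⟨hle, hge⟩ := Nat.find_spec (hfar k)
    have hmin := fun {j} => Nat.find_min (hfar k) (m := j)
    generalize Nat.find (hfar k) = n at hle hge hmin
    have hne : n ≠ k := by
      rintro rfl
      rw [dist_self] at hge
      exact hε.not_ge hge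
    obtain ⟨m, rfl⟩ := Nat.exists_eq_succ_of_ne_zero (show n ≠ 0 by omega)
    have hkm : k ≤ m := by omega
    exact ⟨m, hkm, hge, not_le.1 fun h => hmin m.lt_succ_self ⟨hkm, h⟩⟩
  choose m hkm hge hlt using hm
  have hD : Tendsto (fun k => dist (f^[m k + 1] x) (f^[k] x)) atTop (nhds ε) := by
    refine tendsto_of_tendsto_of_tendsto_of_le_of_le tendsto_const_nhds
      (by simpa only [add_zero] using hlim.const_add ε) hge fun k => ?_
    have h := dist_triangle_left (f^[m k + 1] x) (f^[k] x) (f^[m k] x)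
    have h' := hanti (hkm k)
    dsimp only at h' ⊢
    linarith [hlt k]
  refine hε.ne' (hf0 _ _ ε hD ?_)
  have hstep : Tendsto (fun k => dist (dist (f^[m k + 1] x) (f^[k] x))
      (dist (f (f^[m k + 1] x)) (f (f^[k] x)))) atTop (nhds 0) := by
    refine squeeze_zero (fun _ => dist_nonneg) (fun k => ?_) (by simpa using hlim.add hlim)
    refine (dist_dist_dist_le _ _ _ _).trans ?_
    simp only [← Function.iterate_succ_apply' f]
    exact add_le_add_left (hanti ((hkm k).trans (Nat.le_succ _))) _
  exact hD.congr_dist hstep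

/-- Boyd–Wong fixpoint theorem: on a nonempty complete metric
space, a map `f` with `d(fx,fy) ≤ φ(d(x,y))` for an upper-semicontinuous
`φ : [0,∞) → [0,∞)` with `φ(t) < t` for `t > 0` has a unique fixpoint, to
which every Picard sequence converges. -/
theorem boyd_wong_fixpoint
    {X : Type*} [MetricSpace X] [Nonempty X] [CompleteSpace X]
    (φ : NNReal → NNReal)
    (hφusc : ∀ (t : NNReal) (s : ℕ → NNReal), Tendsto s atTop (nhds t) →
      limsup (fun n => φ (s n)) atTop ≤ φ t)
    (hφlt : ∀ t : NNReal, 0 < t → φ t < t)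
    (f : X → X)
    (hf : ∀ x y, nndist (f x) (f y) ≤ φ (nndist x y)) :
    ∃ u : X, f u = u ∧ (∀ v : X, f v = v → v = u) ∧
      ∀ x : X, Tendsto (fun n => f^[n] x) atTop (nhds u) := by
  have hf0 : ∀ (p q : ℕ → X) (t : ℝ), Tendsto (fun n => dist (p n) (q n)) atTop (nhds t) →
      Tendsto (fun n => dist (f (p n)) (f (q n))) atTop (nhds t) → t = 0 := by
    intro p q t hs hr
    lift t to NNReal using ge_of_tendsto' hs fun _ => dist_nonneg
    simp only [← coe_nndist, NNReal.tendsto_coe] at hs hr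
    exact NNReal.coe_eq_zero.2 (eq_zero_of_tendsto_of_le_usc hφusc hφlt hs hr fun n => hf _ _)
  have hlip : LipschitzWith 1 f := by
    refine LipschitzWith.mk_one fun x y => ?_
    rcases eq_or_ne x y with rfl | hxy
    · simp
    · exact_mod_cast (hf x y).trans (hφlt _ (by simpa [pos_iff_ne_zero] using hxy)).le
  have hcauchy : ∀ x, CauchySeq fun n => f^[n] x := by
    intro x
    have hanti : Antitone fun n => dist (f^[n] x) (f^[n + 1] x) := by
      refine antitone_nat_of_succ_le fun n => ?_
      simpa [Function.iterate_succ_apply'] using hlip.dist_le_mul (f^[n] x) (f^[n + 1] x)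
    have hlim := tendsto_atTop_ciInf hanti ⟨0, by rintro _ ⟨n, rfl⟩; exact dist_nonneg⟩
    have hlim' := hlim.comp (tendsto_add_atTop_nat 1)
    have h0 := hf0 _ _ _ hlim (by
      simpa only [Function.comp_def, Function.iterate_succ_apply'] using hlim')
    rw [h0] at hlim
    exact cauchySeq_iterate_of_eq_zero hf0 hanti hlim
  have huniq : ∀ u v, f u = u → f v = v → v = u := by
    intro u v hu hv
    exact dist_eq_zero.1 (hf0 (fun _ => v) (fun _ => u) _ tendsto_const_nhds
      (by simp only [hu, hv]; exact tendsto_const_nhds))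
  have hfix : ∀ x, ∃ u, f u = u ∧ Tendsto (fun n => f^[n] x) atTop (nhds u) := by
    intro x
    obtain ⟨u, hu⟩ := cauchySeq_tendsto_of_complete (hcauchy x)
    exact ⟨u, isFixedPt_of_tendsto_iterate hu hlip.continuous.continuousAt, hu⟩
  obtain ⟨u, hu, -⟩ := hfix (Classical.arbitrary X)
  refine ⟨u, hu, fun v hv => huniq u v hu hv, fun x => ?_⟩
  obtain ⟨v, hv, hx⟩ := hfix x
  rwa [huniq u v hu hv] at hx
end

section
/- Fixpoint theorem for fuzzy orders: Let * be a left-continuous t-norm on I = [0,1], let (P, e) be a Cauchy-complete fuzzy preorder over *, and let φ : I → I be sequentially lower-semicontinuous with φ(t) > t for all t with 0 < t < 1 and φ(1) = 1. Let f : P → P satisfy φ(e(x,y)) ≤ e(f x, f y) for all x, y ∈ P. If there exists x ∈ P with e(x, f x) ≠ 0 and e(f x, x) ≠ 0, then there exists u ∈ P with e(y, u) = ⨆_{N∈ℕ} ⨅_{n ≥ N} e(y, f^n x) for all y ∈ P and e(f u, u) = 1 = e(u, f u). -/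
instance : Fact ((0 : ℝ) ≤ 1) := ⟨zero_le_one⟩

/-- A left-continuous t-norm on the unit interval. -/
structure IsLeftContTNorm (star : unitInterval → unitInterval → unitInterval) : Prop where
  comm : ∀ a b, star a b = star b a
  assoc : ∀ a b c, star (star a b) c = star a (star b c)
  one : ∀ a, star a 1 = a
  star_sSup : ∀ (a : unitInterval) (S : Set unitInterval), star a (sSup S) = ⨆ s ∈ S, star a s

/-- A gauge for contractions: sequentially lower-semicontinuous, strictly above the identity
inside the unit interval, and fixing `1`. -/
structure IsGauge (φ : unitInterval → unitInterval) : Prop where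
  lsc : ∀ t : ℕ → unitInterval, φ (⨆ N, ⨅ n ≥ N, t n) ≤ ⨆ N, ⨅ n ≥ N, φ (t n)
  lt_apply : ∀ t : unitInterval, 0 < t → t < 1 → t < φ t
  one : φ 1 = 1

section Liminf

variable {α : Type*} [CompleteLinearOrder α] {t : ℕ → α} {q s : α}

theorem exists_forall_lt_of_lt_iSup_iInf (h : q < ⨆ N, ⨅ n ≥ N, t n) :
    ∃ N, ∀ n ≥ N, q < t n := by
  obtain ⟨N, hN⟩ := lt_iSup_iff.1 h
  exact ⟨N, fun n hn => hN.trans_le (iInf₂_le n hn)⟩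

theorem le_iSup_iInf_of_forall_le {N : ℕ} (h : ∀ n ≥ N, q ≤ t n) :
    q ≤ ⨆ N, ⨅ n ≥ N, t n :=
  (le_iInf₂ h).trans (le_iSup (fun N => ⨅ n ≥ N, t n) N)

variable [DenselyOrdered α]

theorem le_iSup_iInf_of_forall_lt (h : ∀ q < s, ∃ N, ∀ n ≥ N, q < t n) :
    s ≤ ⨆ N, ⨅ n ≥ N, t n := by
  refine le_of_forall_lt_imp_le_of_dense fun q hq => ?_
  obtain ⟨N, hN⟩ := h q hq
  exact le_iSup_iInf_of_forall_le fun n hn => (hN n hn).le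

theorem iSup_iInf_succ_le : (⨆ N, ⨅ n ≥ N, t (n + 1)) ≤ ⨆ N, ⨅ n ≥ N, t n := by
  refine le_iSup_iInf_of_forall_lt fun q hq => ?_
  obtain ⟨N, hN⟩ := exists_forall_lt_of_lt_iSup_iInf hq
  refine ⟨N + 1, fun n hn => ?_⟩
  obtain ⟨k, rfl⟩ : ∃ k, n = k + 1 := ⟨n - 1, by omega⟩
  exact hN k (by omega)

end Liminf

namespace IsLeftContTNorm

variable {star : unitInterval → unitInterval → unitInterval} (hs : IsLeftContTNorm star)
include hs

theorem star_iSup {ι : Type*} (a : unitInterval) (g : ι → unitInterval) :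
    star a (⨆ i, g i) = ⨆ i, star a (g i) := by
  rw [← sSup_range, hs.star_sSup, iSup_range]

theorem mono_right (a : unitInterval) {b c : unitInterval} (h : b ≤ c) :
    star a b ≤ star a c := by
  have key := hs.star_sSup a {b, c}
  rw [sSup_pair, sup_eq_right.2 h] at key
  rw [key]
  exact le_iSup₂ (f := fun s (_ : s ∈ ({b, c} : Set unitInterval)) => star a s) b (by simp)

theorem mono {a b c d : unitInterval} (h : a ≤ b) (h' : c ≤ d) : star a c ≤ star b d := by
  refine (hs.mono_right a h').trans ?_
  rw [hs.comm a, hs.comm b]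
  exact hs.mono_right d h

theorem exists_lt_star {a q : unitInterval} (h : q < a) :
    ∃ r < 1, ∀ t, r ≤ t → q < star a t := by
  have h1 : sSup (Set.Iio (1 : unitInterval)) = 1 :=
    (isLUB_Iio (a := (1 : unitInterval))).sSup_eq
  have h2 := hs.star_sSup a (Set.Iio 1)
  rw [h1, hs.one] at h2
  rw [h2] at h
  obtain ⟨r, hr⟩ := lt_iSup_iff.1 h
  obtain ⟨hr1, hr2⟩ := lt_iSup_iff.1 hr
  exact ⟨r, hr1, fun t ht => hr2.trans_le (hs.mono_right a ht)⟩

theorem exists_lt_star_self {q : unitInterval} (h : q < 1) : ∃ r < 1, q < star r r := by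
  obtain ⟨p, hqp, hp⟩ := exists_between h
  obtain ⟨r, hr, hr'⟩ := hs.exists_lt_star hqp
  exact ⟨max p r, max_lt hp hr,
    (hr' _ (le_max_right p r)).trans_le (hs.mono (le_max_left p r) le_rfl)⟩

theorem iSup_star_iSup_le {ι κ : Type*} {g : ι → unitInterval} {h : κ → unitInterval}
    {c : unitInterval} (H : ∀ i j, star (g i) (h j) ≤ c) :
    star (⨆ i, g i) (⨆ j, h j) ≤ c := by
  rw [hs.star_iSup]
  refine iSup_le fun j => ?_
  rw [hs.comm, hs.star_iSup]
  refine iSup_le fun i => ?_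
  rw [hs.comm]
  exact H i j

theorem star_iSup_iInf_le {a : unitInterval} {t t' : ℕ → unitInterval}
    (H : ∀ n, star a (t n) ≤ t' n) :
    star a (⨆ N, ⨅ n ≥ N, t n) ≤ ⨆ N, ⨅ n ≥ N, t' n := by
  rw [hs.star_iSup]
  exact iSup_le fun N => le_iSup_iInf_of_forall_le (N := N)
    fun n hn => (hs.mono_right a (iInf₂_le n hn)).trans (H n)

theorem iSup_iInf_star_iSup_iInf_le {t t' : ℕ → unitInterval} {c : unitInterval}
    (H : ∀ n, star (t n) (t' n) ≤ c) :
    star (⨆ N, ⨅ n ≥ N, t n) (⨆ N, ⨅ n ≥ N, t' n) ≤ c :=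
  hs.iSup_star_iSup_le fun N M => (hs.mono (iInf₂_le (max N M) (le_max_left N M))
    (iInf₂_le (max N M) (le_max_right N M))).trans (H _)

end IsLeftContTNorm

namespace IsGauge

variable {φ : unitInterval → unitInterval} (hφ : IsGauge φ)
include hφ

theorem le_apply {t : unitInterval} (ht : 0 < t) : t ≤ φ t := by
  rcases unitInterval.le_one'.lt_or_eq with h | h
  · exact (hφ.lt_apply t ht h).le
  · rw [h, hφ.one]

theorem pos_of_step {a : ℕ → unitInterval} (h0 : 0 < a 0) (h : ∀ n, φ (a n) ≤ a (n + 1))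
    (n : ℕ) : 0 < a n := by
  induction n with
  | zero => exact h0
  | succ n ih => exact ih.trans_le ((hφ.le_apply ih).trans (h n))

theorem monotone_of_step {a : ℕ → unitInterval} (h0 : 0 < a 0)
    (h : ∀ n, φ (a n) ≤ a (n + 1)) : Monotone a :=
  monotone_nat_of_le_succ fun n => (hφ.le_apply (hφ.pos_of_step h0 h n)).trans (h n)

theorem exists_forall_lt_of_step {a : ℕ → unitInterval} (h0 : 0 < a 0)
    (h : ∀ n, φ (a n) ≤ a (n + 1)) {q : unitInterval} (hq : q < 1) :
    ∃ N, ∀ n ≥ N, q < a n := by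
  have hle : φ (⨆ N, ⨅ n ≥ N, a n) ≤ ⨆ N, ⨅ n ≥ N, a n :=
    (hφ.lsc a).trans ((iSup_mono fun N => iInf₂_mono fun n _ => h n).trans iSup_iInf_succ_le)
  have hpos : 0 < ⨆ N, ⨅ n ≥ N, a n := h0.trans_le
    (le_iSup_iInf_of_forall_le (N := 0) fun n hn => hφ.monotone_of_step h0 h hn)
  refine exists_forall_lt_of_lt_iSup_iInf (hq.trans_le ?_)
  by_contra! hlt
  exact (hφ.lt_apply _ hpos hlt).not_ge hle

theorem eq_one_of_iSup_iInf_eq_one {a b : ℕ → unitInterval}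
    (ha : (⨆ N, ⨅ n ≥ N, a n) = 1) (h : ∀ n, φ (a n) ≤ b (n + 1)) :
    (⨆ N, ⨅ n ≥ N, b n) = 1 := by
  refine le_antisymm unitInterval.le_one' ?_
  calc 1 = φ (⨆ N, ⨅ n ≥ N, a n) := by rw [ha, hφ.one]
    _ ≤ ⨆ N, ⨅ n ≥ N, φ (a n) := hφ.lsc a
    _ ≤ ⨆ N, ⨅ n ≥ N, b (n + 1) := iSup_mono fun N => iInf₂_mono fun n _ => h n
    _ ≤ ⨆ N, ⨅ n ≥ N, b n := iSup_iInf_succ_le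

/-- Orbits of `φ`-contractions are forward Cauchy. -/
theorem forward_cauchy {star : unitInterval → unitInterval → unitInterval}
    (hs : IsLeftContTNorm star) {D : ℕ → ℕ → unitInterval} (hrefl : ∀ n, D n n = 1)
    (htrans : ∀ l m n, star (D l m) (D m n) ≤ D l n)
    (hD : ∀ m n, φ (D m n) ≤ D (m + 1) (n + 1)) (h01 : D 0 1 ≠ 0) (h10 : D 1 0 ≠ 0)
    {q : unitInterval} (hq : q < 1) : ∃ N, ∀ m ≥ N, ∀ n ≥ m, q < D m n := by
  have ha : ∀ r < 1, ∃ N, ∀ n ≥ N, r < D n (n + 1) := fun r hr =>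
    hφ.exists_forall_lt_of_step (a := fun n => D n (n + 1))
      (unitInterval.pos_iff_ne_zero.2 h01) (fun n => hD _ _) hr
  have hb : ∀ r < 1, ∃ N, ∀ n ≥ N, r < D (n + 1) n := fun r hr =>
    hφ.exists_forall_lt_of_step (a := fun n => D (n + 1) n)
      (unitInterval.pos_iff_ne_zero.2 h10) (fun n => hD _ _) hr
  obtain ⟨c, hc, hc1⟩ := exists_between hq
  by_contra! hcon
  have hex : ∀ k, ∃ m ≥ k, ∃ n ≥ m, D m (n + 1) ≤ c ∧ c < D m n := by
    intro k
    obtain ⟨m, hm, n, hn, hmn⟩ := hcon k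
    by_contra! H
    refine (hmn.trans_lt hc).not_gt ?_
    clear hmn
    induction n, hn using Nat.le_induction with
    | base => rw [hrefl]; exact hc1
    | succ n hn ih => exact lt_of_not_ge fun hle => (H m hm n hn hle).not_gt ih
  choose m hm n hn hle hlt using hex
  have hlim : (⨆ N, ⨅ k ≥ N, D (m k) (n k + 1)) = c := by
    refine le_antisymm (iSup_le fun N => (iInf₂_le N le_rfl).trans (hle N)) ?_
    refine le_iSup_iInf_of_forall_lt fun p hp => ?_
    obtain ⟨r, hr, hr'⟩ := hs.exists_lt_star hp
    obtain ⟨N, hN⟩ := ha r hr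
    refine ⟨N, fun k hk => (hr' _ (hN (n k) ?_).le).trans_le
      ((hs.mono (hlt k).le le_rfl).trans (htrans _ _ _))⟩
    exact hk.trans ((hm k).trans (hn k))
  have hcφ : c < φ c := hφ.lt_apply c (unitInterval.nonneg'.trans_lt hc) hc1
  have hlsc := hφ.lsc fun k => D (m k) (n k + 1)
  rw [hlim] at hlsc
  obtain ⟨p, hcp, hp⟩ := exists_between hcφ
  obtain ⟨K, hK⟩ := exists_forall_lt_of_lt_iSup_iInf (hp.trans_le hlsc)
  obtain ⟨p', hcp', hp'⟩ := exists_between hcp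
  obtain ⟨r, hr, hr'⟩ := hs.exists_lt_star hp'
  obtain ⟨r', hr1, hr1'⟩ := hs.exists_lt_star hcp'
  obtain ⟨A, hA⟩ := ha r hr
  obtain ⟨B, hB⟩ := hb r' hr1
  let k := max K (max A B)
  have hkK : K ≤ k := le_max_left _ _
  have hkm : max A B ≤ m k := (le_max_right _ _).trans (hm k)
  have hkA : A ≤ m k := (le_max_left _ _).trans hkm
  have hkB : B ≤ n k + 1 := (le_max_right A B).trans (hkm.trans ((hn k).trans (Nat.le_succ _)))
  have h1 : p' < D (m k) (n k + 1 + 1) := by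
    refine (hr' _ (hA (m k) hkA).le).trans_le ?_
    rw [hs.comm]
    exact (hs.mono le_rfl ((hK k hkK).le.trans (hD _ _))).trans (htrans _ _ _)
  have h2 : c < D (m k) (n k + 1) :=
    (hr1' _ (hB _ hkB).le).trans_le ((hs.mono h1.le le_rfl).trans (htrans _ _ _))
  exact h2.not_ge (hle k)

end IsGauge

/-- Fixpoint theorem for fuzzy orders: over a left-continuous
t-norm `⋆` on `[0,1]`, a `φ`-contraction on a Cauchy-complete fuzzy preorder,
with `φ` sequentially lower-semicontinuous, `φ(t) > t` for `0 < t < 1`,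
`φ(1) = 1`, and some `x` with `e(x,fx) ≠ 0 ≠ e(fx,x)`, has a fixpoint `u`
representing the presheaf `φ_{x,f}`. -/
theorem fuzzy_order_fixpoint
    (star : unitInterval → unitInterval → unitInterval)
    (hcomm : ∀ a b, star a b = star b a)
    (hassoc : ∀ a b c, star (star a b) c = star a (star b c))
    (hone : ∀ a, star a 1 = a)
    (hleftcont : ∀ (a : unitInterval) (S : Set unitInterval),
      star a (sSup S) = ⨆ s ∈ S, star a s)
    {P : Type*} (e : P → P → unitInterval)
    (he_refl : ∀ x, e x x = 1)
    (he_trans : ∀ x y z, star (e x y) (e y z) ≤ e x z)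
    (hcc : ∀ Φ Ψ : P → unitInterval,
      (∀ y y', star (e y' y) (Φ y) ≤ Φ y') →
      (∀ y y', star (Ψ y) (e y y') ≤ Ψ y') →
      (1 ≤ ⨆ y, star (Ψ y) (Φ y)) →
      (∀ y y', star (Φ y) (Ψ y') ≤ e y y') →
      ∃ u, (∀ y, Φ y = e y u) ∧ (∀ y, Ψ y = e u y))
    (φ : unitInterval → unitInterval)
    (hφ_lsc : ∀ t : ℕ → unitInterval, φ (⨆ N, ⨅ n ≥ N, t n) ≤ ⨆ N, ⨅ n ≥ N, φ (t n))
    (hφ_gt : ∀ t : unitInterval, 0 < t → t < 1 → t < φ t)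
    (hφ_one : φ 1 = 1)
    (f : P → P)
    (hf : ∀ x y, φ (e x y) ≤ e (f x) (f y))
    (x : P) (hx₁ : e x (f x) ≠ 0) (hx₂ : e (f x) x ≠ 0) :
    ∃ u : P, (∀ y, e y u = ⨆ N, ⨅ n ≥ N, e y (f^[n] x)) ∧
      e (f u) u = 1 ∧ e u (f u) = 1 := by
  have hs : IsLeftContTNorm star := ⟨hcomm, hassoc, hone, hleftcont⟩
  have hg : IsGauge φ := ⟨hφ_lsc, hφ_gt, hφ_one⟩
  have hstep : ∀ m n, φ (e (f^[m] x) (f^[n] x)) ≤ e (f^[m + 1] x) (f^[n + 1] x) := fun m n => by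
    rw [Function.iterate_succ_apply', Function.iterate_succ_apply']
    exact hf _ _
  have hpresheaf : ∀ y y', star (e y' y) (⨆ N, ⨅ n ≥ N, e y (f^[n] x)) ≤
      ⨆ N, ⨅ n ≥ N, e y' (f^[n] x) := fun y y' => hs.star_iSup_iInf_le fun n => he_trans _ _ _
  have hcopresheaf : ∀ y y', star (⨆ N, ⨅ n ≥ N, e (f^[n] x) y) (e y y') ≤
      ⨆ N, ⨅ n ≥ N, e (f^[n] x) y' := fun y y' => by
    rw [hcomm]
    exact hs.star_iSup_iInf_le fun n => by rw [hcomm]; exact he_trans _ _ _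
  have hunit : 1 ≤ ⨆ y, star (⨆ N, ⨅ n ≥ N, e (f^[n] x) y) (⨆ N, ⨅ n ≥ N, e y (f^[n] x)) := by
    refine le_of_forall_lt_imp_le_of_dense fun q hq => ?_
    obtain ⟨r, hr, hqr⟩ := hs.exists_lt_star_self hq
    obtain ⟨N, hN⟩ := hg.forward_cauchy hs (D := fun m n => e (f^[m] x) (f^[n] x))
      (fun n => he_refl _) (fun l m n => he_trans _ _ _) hstep hx₁ hx₂ hr
    obtain ⟨M, hM⟩ := hg.forward_cauchy hs (D := fun m n => e (f^[n] x) (f^[m] x))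
      (fun n => he_refl _) (fun l m n => by rw [hcomm]; exact he_trans _ _ _)
      (fun m n => hstep n m) hx₂ hx₁ hr
    refine hqr.le.trans (le_trans (hs.mono ?_ ?_) (le_iSup
      (fun y => star (⨆ N, ⨅ n ≥ N, e (f^[n] x) y) (⨆ N, ⨅ n ≥ N, e y (f^[n] x)))
      (f^[max N M] x)))
    · exact le_iSup_iInf_of_forall_le fun n hn => (hM _ (le_max_right N M) n hn).le
    · exact le_iSup_iInf_of_forall_le fun n hn => (hN _ (le_max_left N M) n hn).le
  obtain ⟨u, hu, hu'⟩ := hcc (fun y => ⨆ N, ⨅ n ≥ N, e y (f^[n] x))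
    (fun y => ⨆ N, ⨅ n ≥ N, e (f^[n] x) y) hpresheaf hcopresheaf hunit
    fun y y' => hs.iSup_iInf_star_iSup_iInf_le fun n => he_trans _ _ _
  refine ⟨u, fun y => (hu y).symm, ?_, ?_⟩
  · rw [← hu]
    refine hg.eq_one_of_iSup_iInf_eq_one ((hu u).trans (he_refl u)) fun n => ?_
    rw [Function.iterate_succ_apply']
    exact hf _ _
  · rw [← hu']
    refine hg.eq_one_of_iSup_iInf_eq_one ((hu' u).trans (he_refl u)) fun n => ?_
    rw [Function.iterate_succ_apply']
    exact hf _ _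
end

section
/- Fixpoint theorem for probabilistic metric spaces: Let * be a left-continuous t-norm on I = [0,1] and let Δ be the set of distance distributions u : [0,∞] → I with u(t) = ⨆_{s<t} u(s) for all t, ordered pointwise, with convolution (u ⊛ v)(t) = ⨆_{r+s=t} u(r) * v(s) and unit e (e(0) = 0, e(t) = 1 for t > 0). Let (X, d) be a Cauchy-complete generalized probabilistic metric space over *, and let φ : Δ → Δ be a sequentially lower-semicontinuous control function, i.e. u ≤ φ(u) for all u ∈ Δ and φ(u) = u implies u = 0 or e ≤ u. Let f : X → X satisfy φ(d(x,y)) ≤ d(f x, f y) in Δ for all x, y ∈ X. If there exists x ∈ X with d(x, f x) ≠ 0 and d(f x, x) ≠ 0 in Δ, then f has a fixpoint: there exists u ∈ X with e ≤ d(f u, u) and e ≤ d(u, f u), i.e. d(f u, u)(t) = 1 = d(u, f u)(t) for all t > 0. -/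
/-- The set `Δ` of distance distributions: left-continuous maps
`[0,∞] → [0,1]`. -/
def DDist : Type := {u : ENNReal → unitInterval // ∀ t, u t = ⨆ s, ⨆ _ : s < t, u s}

namespace DDist

instance : PartialOrder DDist := Subtype.partialOrder _

/-- Suprema in `Δ` are computed pointwise. -/
noncomputable instance : SupSet DDist where
  sSup S := ⟨fun t => ⨆ u ∈ S, u.1 t, by
    intro t
    apply le_antisymm
    · refine iSup₂_le fun u hu => ?_
      rw [u.2 t]
      exact iSup₂_le fun s hs =>
        le_iSup₂_of_le s hs (le_iSup₂ (f := fun (u : DDist) (_ : u ∈ S) => u.1 s) u hu)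
    · refine iSup₂_le fun s hs => iSup₂_le fun u hu => ?_
      refine le_iSup₂_of_le u hu ?_
      rw [u.2 t]
      exact le_iSup₂ (f := fun s' (_ : s' < t) => u.1 s') s hs⟩

/-- `Δ` is a complete lattice (with pointwise suprema). -/
noncomputable instance : CompleteLattice DDist :=
  completeLatticeOfSup DDist (fun S =>
    ⟨fun u hu => show u.1 ≤ _ from fun t =>
        le_iSup₂ (f := fun (u : DDist) (_ : u ∈ S) => u.1 t) u hu,
     fun v hv => show _ ≤ v.1 from fun t => iSup₂_le fun u hu => hv hu t⟩)

/-- The unit distance distribution `e`. -/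
noncomputable def unit : DDist :=
  ⟨fun t => if t = 0 then 0 else 1, by
    intro t
    by_cases ht : t = 0
    · subst ht
      simp only [if_pos rfl]
      apply le_antisymm
      · exact bot_le
      · exact iSup₂_le fun s hs => absurd hs (not_lt_bot)
    · show (if t = 0 then (0:unitInterval) else 1) = _
      rw [if_neg ht]
      obtain ⟨s, hs0, hst⟩ := exists_between (pos_iff_ne_zero.mpr ht)
      apply le_antisymm
      · refine le_iSup₂_of_le s hst ?_
        show (1 : unitInterval) ≤ if s = 0 then 0 else 1
        rw [if_neg (pos_iff_ne_zero.mp hs0)]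
      · refine iSup₂_le fun s' _ => ?_
        show (if s' = 0 then (0:unitInterval) else 1) ≤ 1
        exact unitInterval.le_one'⟩

/-- Convolution of (raw) distance distributions with respect to a t-norm. -/
noncomputable def conv (star : unitInterval → unitInterval → unitInterval)
    (u v : ENNReal → unitInterval) : ENNReal → unitInterval :=
  fun t => ⨆ r, ⨆ s, ⨆ _ : r + s = t, star (u r) (v s)

end DDist

namespace DDist

theorem apply_mono (u : DDist) : Monotone u.1 := by
  intro s t hst
  rcases hst.eq_or_lt with rfl | h
  · exact le_rfl
  · rw [u.2 t]
    exact le_iSup₂ (f := fun s' (_ : s' < t) => u.1 s') s h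

theorem apply_zero (u : DDist) : u.1 0 = 0 := by
  rw [u.2 0]
  exact le_antisymm (iSup₂_le fun s hs => absurd hs not_lt_bot) bot_le

theorem iSup_apply {ι : Sort*} (u : ι → DDist) (t : ENNReal) :
    (⨆ i, u i).1 t = ⨆ i, (u i).1 t :=
  iSup_range (f := u) (g := fun v : DDist => v.1 t)

theorem unit_apply {t : ENNReal} (ht : t ≠ 0) : unit.1 t = 1 := if_neg ht

theorem unit_eq_top : unit = ⊤ := by
  refine top_unique fun t => ?_
  by_cases ht : t = 0
  · rw [ht, apply_zero]
    exact bot_le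
  · rw [unit_apply ht]
    exact unitInterval.le_one'

theorem top_apply {t : ENNReal} (ht : t ≠ 0) : (⊤ : DDist).1 t = 1 := by
  rw [← unit_eq_top, unit_apply ht]

/-- The distance distribution with value `0` up to `t` and `p` beyond `t`. -/
noncomputable def step (t : ENNReal) (p : unitInterval) : DDist :=
  ⟨fun s => if t < s then p else 0, by
    intro s
    apply le_antisymm
    · by_cases h : t < s
      · obtain ⟨r, htr, hrs⟩ := exists_between h
        refine le_iSup₂_of_le r hrs ?_
        simp [h, htr]
      · simp only [if_neg h]
        exact bot_le
    · refine iSup₂_le fun r hr => ?_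
      by_cases h : t < r
      · simp [h, h.trans hr]
      · simp only [if_neg h]
        exact bot_le⟩

theorem step_apply {t s : ENNReal} (p : unitInterval) (h : t < s) : (step t p).1 s = p := if_pos h

theorem step_le {t : ENNReal} {p : unitInterval} {u : DDist} (h : p ≤ u.1 t) : step t p ≤ u := by
  intro s
  by_cases hs : t < s
  · rw [step_apply p hs]
    exact h.trans (u.apply_mono hs.le)
  · exact (if_neg hs : (step t p).1 s = 0).trans_le bot_le

theorem step_ne_bot {t : ENNReal} (ht : t ≠ ⊤) {p : unitInterval} (hp : 0 < p) :
    step t p ≠ ⊥ := by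
  intro h
  have h' : step t p ≤ step ⊤ 0 := h ▸ bot_le
  have h₁ := h' ⊤
  rw [step_apply p ht.lt_top] at h₁
  exact hp.not_ge (h₁.trans_eq (by simp [step]))

theorem eq_top_of_step_le {u : DDist}
    (h : ∀ (t : ENNReal) (p : unitInterval), 0 < t → t ≠ ⊤ → 0 < p → p < 1 → step t p ≤ u) :
    u = ⊤ := by
  rw [← unit_eq_top]
  refine le_antisymm (unit_eq_top ▸ le_top) fun t => ?_
  by_cases ht : t = 0
  · rw [ht, apply_zero]
    exact bot_le
  · rw [unit_apply ht]
    obtain ⟨s, hs, hst⟩ := exists_between (pos_iff_ne_zero.mpr ht)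
    refine le_of_forall_lt fun q hq => ?_
    obtain ⟨p, hqp, hp⟩ := exists_between hq
    refine hqp.trans_le ?_
    have := h s p hs hst.ne_top (bot_le.trans_lt hqp) hp t
    rwa [step_apply p hst] at this

/-- The lower limit of a sequence of distance distributions. -/
noncomputable def lowerLimit (u : ℕ → DDist) : DDist := ⨆ N, ⨅ n ≥ N, u n

theorem iInf_le_lowerLimit (u : ℕ → DDist) (N : ℕ) : ⨅ n ≥ N, u n ≤ lowerLimit u :=
  le_iSup (fun N => ⨅ n ≥ N, u n) N

theorem lowerLimit_mono {u v : ℕ → DDist} (h : ∀ n, u n ≤ v n) : lowerLimit u ≤ lowerLimit v :=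
  iSup_mono fun _ => iInf₂_mono fun n _ => h n

theorem lowerLimit_succ_le (u : ℕ → DDist) : lowerLimit (fun n => u (n + 1)) ≤ lowerLimit u := by
  refine iSup_le fun N => le_trans (le_iInf₂ fun n hn => ?_) (iInf_le_lowerLimit u (N + 1))
  obtain ⟨m, rfl⟩ := Nat.exists_eq_add_of_le' hn
  exact iInf₂_le (f := fun n (_ : n ≥ N) => u (n + 1)) (m + N) (Nat.le_add_left N m)

theorem le_lowerLimit_of_forall {u : ℕ → DDist} {v : DDist} (h : ∀ n, v ≤ u n) :
    v ≤ lowerLimit u :=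
  (le_iInf₂ fun n _ => h n).trans (iInf_le_lowerLimit u 0)

theorem lowerLimit_apply_le {u : ℕ → DDist} {t : ENNReal} {p : unitInterval}
    (h : ∀ n, (u n).1 t ≤ p) : (lowerLimit u).1 t ≤ p := by
  rw [lowerLimit, iSup_apply]
  exact iSup_le fun N => le_trans ((iInf₂_le N le_rfl : ⨅ n ≥ N, u n ≤ u N) t) (h N)

/-- Commutativity, unitality and left continuity of a binary operation on the unit interval. -/
structure IsLeftContinuous (star : unitInterval → unitInterval → unitInterval) : Prop where
  comm : ∀ a b, star a b = star b a
  star_one : ∀ a, star a 1 = a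
  star_sSup : ∀ (a : unitInterval) (S : Set unitInterval), star a (sSup S) = ⨆ s ∈ S, star a s

section Convolution

variable {star : unitInterval → unitInterval → unitInterval}

namespace IsLeftContinuous

theorem star_iSup (h : IsLeftContinuous star) {ι : Sort*} (a : unitInterval)
    (b : ι → unitInterval) : star a (⨆ i, b i) = ⨆ i, star a (b i) := by
  rw [iSup, h.star_sSup, iSup_range]

theorem iSup_star (h : IsLeftContinuous star) {ι : Sort*} (a : unitInterval)
    (b : ι → unitInterval) : star (⨆ i, b i) a = ⨆ i, star (b i) a := by
  simp only [h.comm _ a, h.star_iSup]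

theorem mono_right (h : IsLeftContinuous star) (a : unitInterval) {b c : unitInterval}
    (hbc : b ≤ c) : star a b ≤ star a c := by
  have := h.star_sSup a {b, c}
  rw [sSup_pair, sup_eq_right.mpr hbc, iSup_pair] at this
  rw [this]
  exact le_sup_left

theorem mono (h : IsLeftContinuous star) {a b a' b' : unitInterval} (ha : a ≤ a') (hb : b ≤ b') :
    star a b ≤ star a' b' := by
  refine (h.mono_right a hb).trans ?_
  rw [h.comm a, h.comm a']
  exact h.mono_right b' ha

end IsLeftContinuous

theorem conv_le_iff {u v w : ENNReal → unitInterval} :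
    conv star u v ≤ w ↔ ∀ r s, star (u r) (v s) ≤ w (r + s) := by
  refine ⟨fun h r s => le_trans ?_ (h (r + s)), fun h t => ?_⟩
  · exact le_iSup_of_le r (le_iSup₂_of_le s rfl le_rfl)
  · refine iSup_le fun r => iSup₂_le fun s hrs => ?_
    rw [← hrs]
    exact h r s

theorem star_le_conv (u v : ENNReal → unitInterval) (r s : ENNReal) :
    star (u r) (v s) ≤ conv star u v (r + s) :=
  conv_le_iff.mp le_rfl r s

theorem conv_comm (h : IsLeftContinuous star) (u v : ENNReal → unitInterval) :
    conv star u v = conv star v u := by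
  refine le_antisymm (conv_le_iff.mpr fun r s => ?_) (conv_le_iff.mpr fun r s => ?_) <;>
  · rw [h.comm, add_comm]
    exact star_le_conv _ _ _ _

/-- The convolution of two distance distributions is a distance distribution. -/
noncomputable def mul (h : IsLeftContinuous star) (u v : DDist) : DDist :=
  ⟨conv star u.1 v.1, by
    intro t
    apply le_antisymm
    · refine iSup_le fun r => iSup₂_le fun s hrs => ?_
      rw [u.2 r, v.2 s]
      simp only [h.star_iSup, h.iSup_star]
      refine iSup₂_le fun s' hs => iSup₂_le fun r' hr => ?_
      exact le_iSup₂_of_le (r' + s') (hrs ▸ ENNReal.add_lt_add hr hs) (star_le_conv _ _ _ _)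
    · refine iSup₂_le fun t' ht => iSup_le fun r => iSup₂_le fun s hrs => ?_
      have key : r + (s + (t - t')) = t := by
        rw [← add_assoc, hrs, add_tsub_cancel_of_le ht.le]
      refine (h.mono le_rfl (v.apply_mono le_self_add)).trans
        ((star_le_conv u.1 v.1 r (s + (t - t'))).trans_eq ?_)
      rw [key]⟩

theorem mul_le_iff (h : IsLeftContinuous star) {u v w : DDist} :
    mul h u v ≤ w ↔ conv star u.1 v.1 ≤ w.1 := Iff.rfl

theorem mul_comm (h : IsLeftContinuous star) (u v : DDist) : mul h u v = mul h v u :=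
  Subtype.ext (conv_comm h u.1 v.1)

theorem mul_mono (h : IsLeftContinuous star) {u v u' v' : DDist} (hu : u ≤ u') (hv : v ≤ v') :
    mul h u v ≤ mul h u' v' :=
  (mul_le_iff h).mpr <| conv_le_iff.mpr fun r s =>
    (h.mono (hu r) (hv s)).trans (star_le_conv _ _ _ _)

theorem le_top_mul (h : IsLeftContinuous star) (v : DDist) : v ≤ mul h ⊤ v := by
  intro t
  rw [v.2 t]
  refine iSup₂_le fun s hs => ?_
  have key := star_le_conv (star := star) (⊤ : DDist).1 v.1 (t - s) s
  rwa [top_apply (tsub_pos_of_lt hs).ne', h.comm, h.star_one, tsub_add_cancel_of_le hs.le] at key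

theorem iSup_mul_le (h : IsLeftContinuous star) {ι : Sort*} {u : ι → DDist} {v w : DDist}
    (huv : ∀ i, mul h (u i) v ≤ w) : mul h (⨆ i, u i) v ≤ w := by
  refine (mul_le_iff h).mpr <| conv_le_iff.mpr fun r s => ?_
  rw [iSup_apply, h.iSup_star]
  exact iSup_le fun i => conv_le_iff.mp (huv i) r s

theorem mul_iSup_le (h : IsLeftContinuous star) {ι : Sort*} {u v : DDist} {w : ι → DDist}
    (huw : ∀ i, mul h u (w i) ≤ v) : mul h u (⨆ i, w i) ≤ v := by
  rw [mul_comm]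
  exact iSup_mul_le h fun i => (mul_comm h _ _).trans_le (huw i)

theorem mul_lowerLimit_le (h : IsLeftContinuous star) {u v w : ℕ → DDist}
    (huvw : ∀ n, mul h (u n) (v n) ≤ w n) :
    mul h (lowerLimit u) (lowerLimit v) ≤ lowerLimit w := by
  refine iSup_mul_le h fun M => mul_iSup_le h fun N => ?_
  refine le_trans (le_iInf₂ fun n hn => ?_) (iInf_le_lowerLimit w (max M N))
  refine (mul_mono h ?_ ?_).trans (huvw n)
  · exact iInf₂_le n ((le_max_left M N).trans hn)
  · exact iInf₂_le n ((le_max_right M N).trans hn)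

theorem lowerLimit_le_of_mul_le (h : IsLeftContinuous star) {a v u : ℕ → DDist}
    (ha : lowerLimit a = ⊤) (hu : ∀ n, mul h (a n) (v n) ≤ u n) :
    lowerLimit v ≤ lowerLimit u :=
  (le_top_mul h _).trans (ha ▸ mul_lowerLimit_le h hu)

end Convolution

/-- A control function that is sequentially lower-semicontinuous. -/
structure IsControl (φ : DDist → DDist) : Prop where
  le : ∀ u, u ≤ φ u
  eq_bot_or_unit_le : ∀ u, φ u = u → u = ⊥ ∨ unit ≤ u
  lsc : ∀ u : ℕ → DDist, φ (lowerLimit u) ≤ lowerLimit fun n => φ (u n)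

theorem IsControl.lowerLimit_eq_top {φ : DDist → DDist} (hφ : IsControl φ) {u v : ℕ → DDist}
    (huv : ∀ n, φ (u n) ≤ v n) (hvu : lowerLimit v ≤ lowerLimit u) (hu : lowerLimit u ≠ ⊥) :
    lowerLimit u = ⊤ := by
  have h₁ : φ (lowerLimit u) ≤ lowerLimit u := ((hφ.lsc u).trans (lowerLimit_mono huv)).trans hvu
  have h₂ := (hφ.eq_bot_or_unit_le _ (le_antisymm h₁ (hφ.le _))).resolve_left hu
  rwa [unit_eq_top, top_le_iff] at h₂

theorem IsControl.lowerLimit_iterate_eq_top {φ : DDist → DDist} (hφ : IsControl φ) {u : ℕ → DDist}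
    (hu : ∀ n, φ (u n) ≤ u (n + 1)) (h₀ : u 0 ≠ ⊥) : lowerLimit u = ⊤ := by
  have hmono : Monotone u := monotone_nat_of_le_succ fun n => (hφ.le _).trans (hu n)
  refine hφ.lowerLimit_eq_top hu (lowerLimit_succ_le u) ?_
  exact ne_bot_of_le_ne_bot h₀ (le_lowerLimit_of_forall fun n => hmono n.zero_le)

section Cauchy

variable {star : unitInterval → unitInterval → unitInterval} {X : Type*} {d : X → X → DDist}
  {φ : DDist → DDist} {x : ℕ → X}

/-- Distances going forward along an orbit with vanishing steps are eventually small. -/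
theorem exists_forall_lt_apply (h : IsLeftContinuous star) (hφ : IsControl φ)
    (hrefl : ∀ x, unit ≤ d x x) (htrans : ∀ x y z, mul h (d x y) (d y z) ≤ d x z)
    (hx : ∀ m n, φ (d (x m) (x n)) ≤ d (x (m + 1)) (x (n + 1)))
    (hfwd : d (x 0) (x 1) ≠ ⊥) (hbwd : d (x 1) (x 0) ≠ ⊥)
    {t : ENNReal} {p : unitInterval} (ht : 0 < t) (ht' : t ≠ ⊤) (hp : 0 < p) (hp' : p < 1) :
    ∃ N, ∀ n ≥ N, ∀ k, p < (d (x n) (x (n + k))).1 t := by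
  have ha : lowerLimit (fun n => d (x n) (x (n + 1))) = ⊤ :=
    hφ.lowerLimit_iterate_eq_top (fun n => hx n (n + 1)) hfwd
  have hb : lowerLimit (fun n => d (x (n + 1)) (x n)) = ⊤ :=
    hφ.lowerLimit_iterate_eq_top (fun n => hx (n + 1) n) hbwd
  by_contra! hcon
  have hmin : ∀ N, ∃ n ≥ N, ∃ k, p < (d (x n) (x (n + k))).1 t ∧
      (d (x n) (x (n + k + 1))).1 t ≤ p := by
    intro N
    obtain ⟨n, hn, hk⟩ := hcon N
    classical
    have hzero : p < (d (x n) (x (n + 0))).1 t := by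
      refine hp'.trans_le ?_
      rw [← unit_apply ht.ne']
      exact hrefl (x n) t
    obtain ⟨k, hk'⟩ : ∃ k, Nat.find hk = k + 1 := by
      refine Nat.exists_eq_succ_of_ne_zero fun h0 => ?_
      have := Nat.find_spec hk
      rw [h0] at this
      exact hzero.not_ge this
    refine ⟨n, hn, k, not_le.mp (Nat.find_min hk (by omega)), ?_⟩
    have := Nat.find_spec hk
    rwa [hk'] at this
  choose n hn k hlt hle using hmin
  have tail : ∀ {a : ℕ → DDist} (g : ℕ → ℕ), (∀ N, N ≤ g N) → lowerLimit a = ⊤ →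
      lowerLimit (fun N => a (g N)) = ⊤ := by
    intro a g hg hlim
    refine top_unique (hlim ▸ iSup_mono fun N => le_iInf₂ fun m hm => ?_)
    exact iInf₂_le (g m) (hm.trans (hg m))
  have hak := tail (fun N => n N + k N) (fun N => (hn N).trans (Nat.le_add_right _ _)) ha
  have han := tail n hn ha
  have hbk := tail (fun N => n N + k N + 1) (fun N => (hn N).trans (by omega)) hb
  have hne : lowerLimit (fun N => d (x (n N)) (x (n N + k N + 1))) ≠ ⊥ := by
    refine ne_bot_of_le_ne_bot (step_ne_bot ht' hp)
      ((le_lowerLimit_of_forall fun N => step_le (hlt N).le).trans ?_)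
    refine lowerLimit_le_of_mul_le h hak fun N => ?_
    rw [mul_comm]
    exact htrans _ _ _
  have hback : lowerLimit (fun N => d (x (n N + 1)) (x (n N + k N + 1 + 1))) ≤
      lowerLimit fun N => d (x (n N)) (x (n N + k N + 1)) := by
    refine le_trans (lowerLimit_le_of_mul_le (u := fun N => d (x (n N + 1)) (x (n N + k N + 1)))
      h hbk fun N => ?_) (lowerLimit_le_of_mul_le h han fun N => htrans _ _ _)
    rw [mul_comm]
    exact htrans _ _ _
  have htop := hφ.lowerLimit_eq_top (fun N => hx _ _) hback hne
  have := lowerLimit_apply_le hle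
  rw [htop, top_apply ht.ne'] at this
  exact this.not_gt hp'

/-- An orbit of a contraction is a Cauchy sequence. -/
theorem iSup_iInf_dist_eq_top (h : IsLeftContinuous star) (hφ : IsControl φ)
    (hrefl : ∀ x, unit ≤ d x x) (htrans : ∀ x y z, mul h (d x y) (d y z) ≤ d x z)
    (hx : ∀ m n, φ (d (x m) (x n)) ≤ d (x (m + 1)) (x (n + 1)))
    (hfwd : d (x 0) (x 1) ≠ ⊥) (hbwd : d (x 1) (x 0) ≠ ⊥) :
    ⨆ N, ⨅ m ≥ N, ⨅ n ≥ N, d (x m) (x n) = ⊤ := by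
  refine eq_top_of_step_le fun t p ht ht' hp hp' => ?_
  obtain ⟨M, hM⟩ := exists_forall_lt_apply h hφ hrefl htrans hx hfwd hbwd ht ht' hp hp'
  obtain ⟨N, hN⟩ := exists_forall_lt_apply (d := fun y z => d z y) h hφ hrefl
    (fun y z w => (mul_comm h _ _).trans_le (htrans w z y)) (fun m n => hx n m) hbwd hfwd
    ht ht' hp hp'
  refine le_iSup_of_le (max M N) (le_iInf₂ fun m hm => le_iInf₂ fun n hn => step_le ?_)
  rcases le_total m n with hmn | hnm
  · obtain ⟨k, rfl⟩ := Nat.exists_eq_add_of_le hmn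
    exact (hM m ((le_max_left _ _).trans hm) k).le
  · obtain ⟨k, rfl⟩ := Nat.exists_eq_add_of_le hnm
    exact (hN n ((le_max_right _ _).trans hn) k).le

/-- The pair of presheaves induced by a Cauchy sequence satisfies the unit inequality of an
adjunction. -/
theorem unit_le_iSup_conv (h : IsLeftContinuous star)
    (hc : ⨆ N, ⨅ m ≥ N, ⨅ n ≥ N, d (x m) (x n) = ⊤) :
    unit.1 ≤ ⨆ y, conv star (lowerLimit fun n => d (x n) y).1
      (lowerLimit fun n => d y (x n)).1 := by
  set c : ℕ → DDist := fun N => ⨅ m ≥ N, ⨅ n ≥ N, d (x m) (x n)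
  have hmono : Monotone c := fun M N hMN => le_iInf₂ fun m hm => le_iInf₂ fun n hn =>
    (iInf₂_le m (hMN.trans hm)).trans (iInf₂_le n (hMN.trans hn))
  have hΨ : ∀ N, c N ≤ lowerLimit fun n => d (x n) (x N) := fun N =>
    le_trans (le_iInf₂ fun m hm => (iInf₂_le m hm).trans (iInf₂_le N le_rfl))
      (iInf_le_lowerLimit _ N)
  have hΦ : ∀ N, c N ≤ lowerLimit fun n => d (x N) (x n) := fun N =>
    le_trans (iInf₂_le N le_rfl) (iInf_le_lowerLimit _ N)
  suffices key : mul h ⊤ ⊤ ≤ ⨆ y, mul h (lowerLimit fun n => d (x n) y)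
      (lowerLimit fun n => d y (x n)) by
    intro t
    have := (unit_eq_top.trans_le ((le_top_mul h ⊤).trans key)) t
    rw [iSup_apply] at this
    rw [_root_.iSup_apply]
    exact this
  rw [← hc]
  refine iSup_mul_le h fun M => mul_iSup_le h fun N => le_iSup_of_le (x (max M N)) ?_
  exact mul_mono h ((hmono (le_max_left M N)).trans (hΨ _)) ((hmono (le_max_right M N)).trans (hΦ _))

end Cauchy

end DDist

/-- Fixpoint theorem for probabilistic metric spaces: over the
quantale `Δ` of distance distributions (with convolution for a left-continuous
t-norm `⋆` and unit `e`), a `φ`-contraction on a Cauchy-complete generalized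
probabilistic metric space, with `φ` a sequentially lower-semicontinuous
control function, admitting `x` with `d(x,fx) ≠ 0 ≠ d(fx,x)`, has a fixpoint. -/
theorem probabilistic_metric_fixpoint
    (star : unitInterval → unitInterval → unitInterval)
    (hcomm : ∀ a b, star a b = star b a)
    (hassoc : ∀ a b c, star (star a b) c = star a (star b c))
    (hone : ∀ a, star a 1 = a)
    (hleftcont : ∀ (a : unitInterval) (S : Set unitInterval),
      star a (sSup S) = ⨆ s ∈ S, star a s)
    {X : Type*} (d : X → X → DDist)
    (hd_refl : ∀ x, DDist.unit ≤ d x x)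
    (hd_trans : ∀ x y z, DDist.conv star (d x y).1 (d y z).1 ≤ (d x z).1)
    (hcc : ∀ Φ Ψ : X → DDist,
      (∀ y y', DDist.conv star (d y' y).1 (Φ y).1 ≤ (Φ y').1) →
      (∀ y y', DDist.conv star (Ψ y).1 (d y y').1 ≤ (Ψ y').1) →
      (DDist.unit.1 ≤ ⨆ y, DDist.conv star (Ψ y).1 (Φ y).1) →
      (∀ y y', DDist.conv star (Φ y).1 (Ψ y').1 ≤ (d y y').1) →
      ∃ u, (∀ y, Φ y = d y u) ∧ (∀ y, Ψ y = d u y))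
    (φ : DDist → DDist)
    (hφ_le : ∀ u, u ≤ φ u)
    (hφ_fix : ∀ u, φ u = u → u = ⊥ ∨ DDist.unit ≤ u)
    (hφ_lsc : ∀ u : ℕ → DDist, φ (⨆ N, ⨅ n ≥ N, u n) ≤ ⨆ N, ⨅ n ≥ N, φ (u n))
    (f : X → X)
    (hf : ∀ x y, φ (d x y) ≤ d (f x) (f y))
    (x : X) (hx₁ : d x (f x) ≠ ⊥) (hx₂ : d (f x) x ≠ ⊥) :
    ∃ u : X, DDist.unit ≤ d (f u) u ∧ DDist.unit ≤ d u (f u) ∧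
      ∀ t : ENNReal, t ≠ 0 → (d (f u) u).1 t = 1 ∧ (d u (f u)).1 t = 1 := by
  have h : DDist.IsLeftContinuous star := ⟨hcomm, hone, hleftcont⟩
  have hφ : DDist.IsControl φ := ⟨hφ_le, hφ_fix, hφ_lsc⟩
  have htrans : ∀ x y z, DDist.mul h (d x y) (d y z) ≤ d x z := hd_trans
  let o : ℕ → X := fun n => f^[n] x
  have ho : ∀ n, o (n + 1) = f (o n) := fun n => Function.iterate_succ_apply' f n x
  have hcauchy := DDist.iSup_iInf_dist_eq_top (x := o) h hφ hd_refl htrans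
    (fun m n => by rw [ho, ho]; exact hf _ _) hx₁ hx₂
  obtain ⟨u, hΦ, hΨ⟩ := hcc (fun y => DDist.lowerLimit fun n => d y (o n))
    (fun y => DDist.lowerLimit fun n => d (o n) y)
    (fun y y' => (DDist.mul_le_iff h).mp <| DDist.mul_iSup_le h fun N =>
      le_trans (le_iInf₂ fun n hn => (DDist.mul_mono h le_rfl (iInf₂_le n hn)).trans
        (htrans y' y (o n))) (DDist.iInf_le_lowerLimit _ N))
    (fun y y' => (DDist.mul_le_iff h).mp <| DDist.iSup_mul_le h fun N =>
      le_trans (le_iInf₂ fun n hn => (DDist.mul_mono h (iInf₂_le n hn) le_rfl).trans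
        (htrans (o n) y y')) (DDist.iInf_le_lowerLimit _ N))
    (DDist.unit_le_iSup_conv h hcauchy)
    (fun y y' => (DDist.mul_le_iff h).mp <| DDist.iSup_mul_le h fun M => DDist.mul_iSup_le h
      fun N => (DDist.mul_mono h (iInf₂_le (max M N) (le_max_left M N))
        (iInf₂_le (max M N) (le_max_right M N))).trans (htrans y (o (max M N)) y'))
  have h₁ : DDist.unit ≤ d (f u) u := by
    rw [← hΦ (f u)]
    refine ((hd_refl u).trans (hΦ u).ge).trans (le_trans ?_ (DDist.lowerLimit_succ_le _))
    refine DDist.lowerLimit_mono fun n => ?_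
    rw [ho]
    exact (hφ_le _).trans (hf _ _)
  have h₂ : DDist.unit ≤ d u (f u) := by
    rw [← hΨ (f u)]
    refine ((hd_refl u).trans (hΨ u).ge).trans (le_trans ?_ (DDist.lowerLimit_succ_le _))
    refine DDist.lowerLimit_mono fun n => ?_
    rw [ho]
    exact (hφ_le _).trans (hf _ _)
  refine ⟨u, h₁, h₂, fun t ht => ⟨?_, ?_⟩⟩
  · exact le_antisymm unitInterval.le_one' ((DDist.unit_apply ht).ge.trans (h₁ t))
  · exact le_antisymm unitInterval.le_one' ((DDist.unit_apply ht).ge.trans (h₂ t))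
end

section
/- Let u : [0,∞] → [0,1] satisfy u(t) = ⨆_{s<t} u(s) for all t ∈ [0,∞] (left-continuity) and u(∞) = 1. If there exists K with 1 < K < ∞ such that u(t) = u(K·t) for all t ∈ [0,∞], then u(t) = 1 for all t > 0; that is, u = e, where e(0) = 0 and e(t) = 1 for t > 0. -/
/-- a left-continuous distance distribution `u : [0,∞] → [0,1]`
with `u(∞) = 1` that is invariant under scaling by some `1 < K < ∞` equals the
unit `e` (i.e. `u(t) = 1` for all `t > 0`). -/
theorem banach_control_fixpoint_is_unit
    (u : ENNReal → unitInterval)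
    (hlc : ∀ t : ENNReal, u t = ⨆ s, ⨆ _ : s < t, u s)
    (hu_top : u ⊤ = 1)
    (K : ENNReal) (hK₁ : 1 < K) (hK₂ : K < ⊤)
    (hfix : ∀ t : ENNReal, u t = u (K * t)) :
    ∀ t : ENNReal, t ≠ 0 → u t = 1 := by
  intro t ht
  have hmono {a b : ENNReal} (hab : a < b) : u a ≤ u b := by
    rw [hlc b]
    exact le_iSup₂_of_le a hab le_rfl
  have hpow (n : ℕ) : u (K ^ n * t) = u t := by
    induction n with
    | zero => simp
    | succ n ih => rw [pow_succ', mul_assoc, ← hfix, ih]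
  have htend : Filter.Tendsto (fun n : ℕ => K ^ n * t) Filter.atTop (nhds ⊤) := by
    have h := ENNReal.Tendsto.mul_const (b := t)
      (ENNReal.tendsto_pow_atTop_nhds_top_iff.2 hK₁) (Or.inl ENNReal.top_ne_zero)
    rwa [ENNReal.top_mul ht] at h
  refine le_antisymm unitInterval.le_one' ?_
  rw [← hu_top, hlc ⊤]
  refine iSup₂_le fun s hs => ?_
  obtain ⟨n, hn⟩ := (htend.eventually (lt_mem_nhds hs)).exists
  exact (hmono hn).trans_eq (hpow n)
end
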